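/- arXiv:0902.0601 — 2 statements merged into one kernel-verified Lean document; each statement's English description precedes it below -/
import Mathlib

section
/- Let G = 𝒮₄ be the symmetric group on four letters (the group of permutations of Fin 4). Then the third group cohomology of G with coefficients in ℤ with the trivial G-action satisfies H³(𝒮₄, ℤ) ≅ ℤ/2ℤ. -/
section Presentation

open Equiv

variable {E : Type*} [Group E]

/-- The products of the form `x * y * z` with `x ∈ {1, a}`, `y ∈ {1, b, b * a}` and
`z ∈ {1, c, c * b, c * b * a}`. -/
def coxeterNormalForms (a b c : E) : Set E :=
  {p | ∃ x y z, (x = 1 ∨ x = a) ∧ (y = 1 ∨ y = b ∨ y = b * a) ∧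
    (z = 1 ∨ z = c ∨ z = c * b ∨ z = c * b * a) ∧ p = x * y * z}

/-- The generators `a`, `b`, `c` of `E` satisfy the Coxeter relations of type `A₃`. -/
structure IsCoxeterTriple (a b c : E) : Prop where
  mul_self_left : a * a = 1
  mul_self_mid : b * b = 1
  mul_self_right : c * c = 1
  braid_left : b * (a * b) = a * (b * a)
  braid_right : c * (b * c) = b * (c * b)
  comm : c * a = a * c

namespace IsCoxeterTriple

variable {a b c : E}

theorem mul_mem_coxeterNormalForms (h : IsCoxeterTriple a b c) {p s : E}
    (hp : p ∈ coxeterNormalForms a b c) (hs : s = a ∨ s = b ∨ s = c) :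
    p * s ∈ coxeterNormalForms a b c := by
  obtain ⟨haa, hbb, hcc, hab, hbc, hac⟩ := h
  have hbc' (x : E) : c * (b * (c * x)) = b * (c * (b * x)) := by
    simpa only [mul_assoc] using congrArg (· * x) hbc
  have hac' (x : E) : c * (a * x) = a * (c * x) := by
    simpa only [mul_assoc] using congrArg (· * x) hac
  have left {x : E} (hx : x = 1 ∨ x = a) : x * a = 1 ∨ x * a = a := by
    rcases hx with rfl | rfl <;> simp [haa]
  have mid {y s : E} (hy : y = 1 ∨ y = b ∨ y = b * a) (hs : s = a ∨ s = b) :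
      ∃ r y', (r = 1 ∨ r = a) ∧ (y' = 1 ∨ y' = b ∨ y' = b * a) ∧ y * s = r * y' := by
    rcases hy with rfl | rfl | rfl <;> rcases hs with rfl | rfl
    · exact ⟨s, 1, by simp⟩
    · exact ⟨1, s, by simp⟩
    · exact ⟨1, y * s, by simp⟩
    · exact ⟨1, 1, by simp [hbb]⟩
    · exact ⟨1, b, by simp [mul_assoc, haa]⟩
    · exact ⟨a, s * a, by simp [mul_assoc, hab]⟩
  have right {z s : E} (hz : z = 1 ∨ z = c ∨ z = c * b ∨ z = c * b * a)
      (hs : s = a ∨ s = b ∨ s = c) :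
      ∃ r z', (r = 1 ∨ r = a ∨ r = b) ∧ (z' = 1 ∨ z' = c ∨ z' = c * b ∨ z' = c * b * a) ∧
        z * s = r * z' := by
    rcases hz with rfl | rfl | rfl | rfl <;> rcases hs with rfl | rfl | rfl
    · exact ⟨s, 1, by simp⟩
    · exact ⟨s, 1, by simp⟩
    · exact ⟨1, s, by simp⟩
    · exact ⟨s, z, by simp [hac]⟩
    · exact ⟨1, z * s, by simp⟩
    · exact ⟨1, 1, by simp [hcc]⟩
    · exact ⟨1, c * b * s, by simp⟩
    · exact ⟨1, c, by simp [mul_assoc, hbb]⟩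
    · exact ⟨b, s * b, by simp [mul_assoc, hbc]⟩
    · exact ⟨1, c * b, by simp [mul_assoc, haa]⟩
    · exact ⟨a, c * s * a, by simp [mul_assoc, hab, hac']⟩
    · exact ⟨b, s * b * a, by simp [mul_assoc, ← hac, hbc']⟩
  obtain ⟨x, y, z, hx, hy, hz, rfl⟩ := hp
  obtain ⟨r, z', hr, hz', hzs⟩ := right hz hs
  obtain ⟨r', y', hr', hy', hyr⟩ :
      ∃ r' y', (r' = 1 ∨ r' = a) ∧ (y' = 1 ∨ y' = b ∨ y' = b * a) ∧ y * r = r' * y' := by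
    rcases hr with rfl | hr
    · exact ⟨1, y, by simpa using hy⟩
    · exact mid hy hr
  refine ⟨x * r', y', z', ?_, hy', hz', ?_⟩
  · rcases hr' with rfl | rfl
    · simpa using hx
    · exact left hx
  · simp only [mul_assoc, hzs]
    simp only [← mul_assoc y r, hyr, mul_assoc]

theorem closure_subset_coxeterNormalForms (h : IsCoxeterTriple a b c) {p : E}
    (hp : p ∈ Subgroup.closure {a, b, c}) : p ∈ coxeterNormalForms a b c := by
  induction hp using Subgroup.closure_induction_right with
  | one => exact ⟨1, 1, 1, by simp⟩
  | mul_right p _ s hs ih => exact h.mul_mem_coxeterNormalForms ih hs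
  | mul_inv_cancel p _ s hs ih =>
    have hs' : s⁻¹ = s := by
      rcases hs with rfl | rfl | rfl
      exacts [inv_eq_of_mul_eq_one_left h.mul_self_left,
        inv_eq_of_mul_eq_one_left h.mul_self_mid, inv_eq_of_mul_eq_one_left h.mul_self_right]
    exact hs'.symm ▸ h.mul_mem_coxeterNormalForms ih hs

theorem prodMk {F : Type*} [Group F] {a' b' c' : F} (h : IsCoxeterTriple a b c)
    (h' : IsCoxeterTriple a' b' c') : IsCoxeterTriple (a, a') (b, b') (c, c') where
  mul_self_left := Prod.ext h.mul_self_left h'.mul_self_left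
  mul_self_mid := Prod.ext h.mul_self_mid h'.mul_self_mid
  mul_self_right := Prod.ext h.mul_self_right h'.mul_self_right
  braid_left := Prod.ext h.braid_left h'.braid_left
  braid_right := Prod.ext h.braid_right h'.braid_right
  comm := Prod.ext h.comm h'.comm

theorem swaps :
    IsCoxeterTriple (swap 0 1 : Perm (Fin 4)) (swap 1 2) (swap 2 3) := by
  constructor <;> decide

end IsCoxeterTriple

theorem closure_swaps_fin_four :
    Subgroup.closure {swap 0 1, swap 1 2, swap 2 3} = (⊤ : Subgroup (Perm (Fin 4))) := by
  refine Subgroup.closure_eq_top_of_mclosure_eq_top ?_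
  rw [← Perm.mclosure_swap_castSucc_succ 3]
  congr 1
  ext g
  simp [Fin.exists_fin_succ, eq_comm]

/-- The Coxeter presentation of the symmetric group on four letters. -/
theorem IsCoxeterTriple.exists_monoidHom {a b c : E} (h : IsCoxeterTriple a b c) :
    ∃ φ : Perm (Fin 4) →* E, φ (swap 0 1) = a ∧ φ (swap 1 2) = b ∧ φ (swap 2 3) = c := by
  let S : Set (E × Perm (Fin 4)) := {(a, swap 0 1), (b, swap 1 2), (c, swap 2 3)}
  let K := Subgroup.closure S
  let π : K →* Perm (Fin 4) := (MonoidHom.snd E (Perm (Fin 4))).comp K.subtype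
  have hinj : Function.Injective π := by
    refine (injective_iff_map_eq_one π).2 ?_
    rintro ⟨⟨p, q⟩, hp⟩ (rfl : q = 1)
    obtain ⟨x, y, z, hx, hy, hz, hpq⟩ :=
      (h.prodMk IsCoxeterTriple.swaps).closure_subset_coxeterNormalForms hp
    have key : x = 1 ∧ y = 1 ∧ z = 1 := by
      have hq := congrArg Prod.snd hpq
      rcases hx with rfl | rfl <;> rcases hy with rfl | rfl | rfl <;>
        rcases hz with rfl | rfl | rfl | rfl <;> first
          | exact ⟨rfl, rfl, rfl⟩
          | exact absurd hq (by simp only [Prod.snd_mul, Prod.snd_one]; decide)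
    obtain ⟨rfl, rfl, rfl⟩ := key
    exact Subtype.ext (by simpa using hpq)
  have hmem {s} (hs : s ∈ S) : s ∈ K := Subgroup.subset_closure hs
  have ha : (a, swap 0 1) ∈ K := hmem (by simp [S])
  have hb : (b, swap 1 2) ∈ K := hmem (by simp [S])
  have hc : (c, swap 2 3) ∈ K := hmem (by simp [S])
  have hsurj : Function.Surjective π := by
    rw [← MonoidHom.range_eq_top, eq_top_iff, ← closure_swaps_fin_four, Subgroup.closure_le]
    rintro g (rfl | rfl | rfl)
    exacts [⟨⟨_, ha⟩, rfl⟩, ⟨⟨_, hb⟩, rfl⟩, ⟨⟨_, hc⟩, rfl⟩]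
  let e := MulEquiv.ofBijective π ⟨hinj, hsurj⟩
  have he {p g} (hp : (p, g) ∈ K) : (e.symm g : E × Perm (Fin 4)).1 = p := by
    have : e.symm g = ⟨(p, g), hp⟩ := e.symm_apply_eq.2 rfl
    rw [this]
  exact ⟨(MonoidHom.fst E _).comp (K.subtype.comp e.symm.toMonoidHom), he ha, he hb, he hc⟩

end Presentation

section CocycleExtension

open groupCohomology

variable {G A : Type} [Group G] [AddCommGroup A]

/-- The set `A × G` with the multiplication twisted by a 2-cocycle `f` of `G` with values in the
trivial module `A`. -/
@[ext]
structure CocycleExtension (f : cocycles₂ (Rep.trivial ℤ G A)) where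
  /-- The component in the kernel. -/
  left : A
  /-- The component in the quotient. -/
  right : G

theorem cocycles₂_trivial_add (f : cocycles₂ (Rep.trivial ℤ G A)) (g h j : G) :
    (f (g * h, j) + f (g, h) : A) = f (h, j) + f (g, h * j) :=
  (mem_cocycles₂_iff f).1 f.2 g h j

namespace CocycleExtension

variable {f : cocycles₂ (Rep.trivial ℤ G A)}

instance : Mul (CocycleExtension f) := ⟨fun x y => ⟨x.1 + y.1 + f (x.2, y.2), x.2 * y.2⟩⟩

instance : One (CocycleExtension f) := ⟨⟨-f (1, 1), 1⟩⟩

instance : Inv (CocycleExtension f) :=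
  ⟨fun x => ⟨-x.1 - f (x.2⁻¹, x.2) - f (1, 1), x.2⁻¹⟩⟩

@[simp] theorem mul_left (x y : CocycleExtension f) :
    (x * y).left = x.left + y.left + f (x.right, y.right) := rfl

@[simp] theorem mul_right (x y : CocycleExtension f) : (x * y).right = x.right * y.right := rfl

@[simp] theorem one_left : (1 : CocycleExtension f).left = -f (1, 1) := rfl

@[simp] theorem one_right : (1 : CocycleExtension f).right = 1 := rfl

@[simp] theorem inv_left (x : CocycleExtension f) :
    x⁻¹.left = -x.left - f (x.right⁻¹, x.right) - f (1, 1) := rfl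

@[simp] theorem inv_right (x : CocycleExtension f) : x⁻¹.right = x.right⁻¹ := rfl

theorem apply_one_left (f : cocycles₂ (Rep.trivial ℤ G A)) (g : G) :
    (f (1, g) : A) = f (1, 1) := cocycles₂_map_one_fst f g

theorem apply_one_right (f : cocycles₂ (Rep.trivial ℤ G A)) (g : G) :
    (f (g, 1) : A) = f (1, 1) := cocycles₂_map_one_snd f g

instance : Group (CocycleExtension f) :=
  Group.ofLeftAxioms
    (fun x y z => by
      ext
      · have := cocycles₂_trivial_add f x.right y.right z.right
        calc x.left + y.left + (f (x.right, y.right) : A) + z.left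
              + (f (x.right * y.right, z.right) : A)
            = x.left + y.left + z.left +
              ((f (x.right * y.right, z.right) : A) + f (x.right, y.right)) := by abel
          _ = x.left + (y.left + z.left + (f (y.right, z.right) : A))
              + (f (x.right, y.right * z.right) : A) := by rw [this]; abel
      · exact mul_assoc ..)
    (fun x => by
      ext
      · simp [apply_one_left f x.right]
      · simp)
    (fun x => by
      ext
      · simp
        abel
      · simp)

/-- The projection of the extension onto the quotient. -/
def rightHom : CocycleExtension f →* G where
  toFun := right
  map_one' := rfl
  map_mul' _ _ := rfl

/-- The inclusion of the kernel in the extension. -/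
def inl (f : cocycles₂ (Rep.trivial ℤ G A)) : Multiplicative A →* CocycleExtension f where
  toFun a := ⟨a.toAdd - f (1, 1), 1⟩
  map_one' := by ext <;> simp
  map_mul' a b := by
    ext
    · simp
      abel
    · simp

theorem inl_mul (a : Multiplicative A) (x : CocycleExtension f) :
    inl f a * x = ⟨a.toAdd + x.left, x.right⟩ := by
  ext
  · simp [inl, apply_one_left f x.right]
    abel
  · simp [inl]

theorem mul_inl (a : Multiplicative A) (x : CocycleExtension f) :
    x * inl f a = inl f a * x := by
  rw [inl_mul]
  ext
  · simp [inl, apply_one_right f x.right]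
    abel
  · simp [inl]

theorem exists_inl_mul_eq {x y : CocycleExtension f} (h : x.right = y.right) :
    ∃ a, inl f a * y = x :=
  ⟨.ofAdd (x.left - y.left), by rw [inl_mul]; ext <;> simp [h]⟩

theorem inl_injective : Function.Injective (inl f) := fun a b h => by
  simpa [inl] using congrArg left h

/-- A cocycle whose extension splits is a coboundary. -/
theorem mem_coboundaries₂_of_section (φ : G →* CocycleExtension f)
    (hφ : rightHom.comp φ = MonoidHom.id G) : ⇑f ∈ coboundaries₂ (Rep.trivial ℤ G A) := by
  have hr (g : G) : (φ g).right = g := DFunLike.congr_fun hφ g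
  refine ⟨fun g => -(φ g).left, funext fun ⟨g, h⟩ => ?_⟩
  have := congrArg left (map_mul φ g h)
  simp only [mul_left, hr] at this
  change -(φ h).left - -(φ (g * h)).left + -(φ g).left = (f (g, h) : A)
  rw [this]
  abel

end CocycleExtension

end CocycleExtension

section CentralScaling

variable {E : Type*} [Group E]

theorem mul_self_eq_one_of_braid {a b z : E} (hz : ∀ x, x * z = z * x) (ha : a * a = 1)
    (hb : b * b = 1) (h : b * (a * b) = z * (a * (b * a))) : z * z = 1 := by
  have h1 : (b * (a * b)) * (b * (a * b)) = 1 := by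
    rw [mul_assoc, mul_assoc a b, ← mul_assoc b b, hb, one_mul, ← mul_assoc a a, ha, one_mul, hb]
  have h2 : (a * (b * a)) * (a * (b * a)) = 1 := by
    rw [mul_assoc, mul_assoc b a, ← mul_assoc a a, ha, one_mul, ← mul_assoc b b, hb, one_mul, ha]
  calc z * z = z * z * ((a * (b * a)) * (a * (b * a))) := by rw [h2, mul_one]
    _ = (z * (a * (b * a))) * (z * (a * (b * a))) := by
      rw [mul_assoc z (a * (b * a)), ← mul_assoc (a * (b * a)) z, hz (a * (b * a))]
      simp only [mul_assoc]
    _ = 1 := by rw [← h, h1]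

theorem mul_mul_mul_self_of_central {b z : E} (hz : ∀ x, x * z = z * x) :
    z * b * (z * b) = z * z * (b * b) := by
  rw [mul_assoc z b, ← mul_assoc b z, hz b]
  simp only [mul_assoc]

theorem braid_of_central {a b z : E} (hz : ∀ x, x * z = z * x) (ha : a * a = 1)
    (hb : b * b = 1) (h : b * (a * b) = z * (a * (b * a))) :
    z * b * (a * (z * b)) = a * (z * b * a) := by
  have hzz := mul_self_eq_one_of_braid hz ha hb h
  calc z * b * (a * (z * b)) = z * z * (b * (a * b)) := by
        rw [← mul_assoc a z, hz a, mul_assoc z a, mul_assoc z b, ← mul_assoc b z, hz b]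
        simp only [mul_assoc]
    _ = a * (z * b * a) := by
      rw [hzz, one_mul, h, mul_assoc z b, ← mul_assoc a z, hz a, mul_assoc z a]

/-- Involutions satisfying the braid relations up to central elements can be rescaled by central
elements to a Coxeter triple. -/
theorem exists_isCoxeterTriple_of_involutions {M : Type*} [CommGroup M] {ι : M →* E}
    (hι : ∀ m x, x * ι m = ι m * x) {a b c : E} (ha : a * a = 1) (hb : b * b = 1) (hc : c * c = 1)
    (hab : ∃ m, b * (a * b) = ι m * (a * (b * a))) (hbc : ∃ m, c * (b * c) = ι m * (b * (c * b)))
    (hac : c * a = a * c) : ∃ β γ, IsCoxeterTriple a (ι β * b) (ι γ * c) := by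
  obtain ⟨β, hβ⟩ := hab
  obtain ⟨δ, hδ⟩ := hbc
  have hb' : ι β * b * (ι β * b) = 1 := by
    rw [mul_mul_mul_self_of_central (hι β), mul_self_eq_one_of_braid (hι β) ha hb hβ, hb, one_mul]
  have hcb : c * (ι β * b * c) = ι (β⁻¹ * δ) * (ι β * b * (c * (ι β * b))) := by
    calc c * (ι β * b * c) = ι β * (c * (b * c)) := by
          rw [mul_assoc, ← mul_assoc c, hι β c, mul_assoc]
      _ = ι β * ι δ * (b * (c * b)) := by rw [hδ, mul_assoc]
      _ = ι (β⁻¹ * δ) * (ι β * ι β) * (b * (c * b)) := by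
          rw [← map_mul, ← map_mul, ← map_mul]
          congr 2
          rw [mul_comm β⁻¹, mul_assoc, inv_mul_cancel_left, mul_comm]
      _ = ι (β⁻¹ * δ) * (ι β * b * (c * (ι β * b))) := by
          rw [← mul_assoc c (ι β), hι β c, mul_assoc (ι β) c, mul_assoc (ι β) b,
            ← mul_assoc b (ι β), hι β b]
          simp only [mul_assoc]
  refine ⟨β, β⁻¹ * δ, ha, hb', ?_, braid_of_central (hι β) ha hb hβ,
    braid_of_central (hι _) hb' hc hcb, ?_⟩
  · rw [mul_mul_mul_self_of_central (hι _), mul_self_eq_one_of_braid (hι _) hb' hc hcb, hc, one_mul]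
  · rw [mul_assoc, hac, ← mul_assoc, ← hι _ a, mul_assoc]

/-- Elements satisfying the Coxeter relations up to central elements, with the commutation
relation holding exactly, can be rescaled to a Coxeter triple. -/
theorem exists_isCoxeterTriple_of_central {M : Type*} [CommGroup M] {ι : M →* E}
    (hι : ∀ m x, x * ι m = ι m * x) (hM : ∀ m : M, ∃ n, n * n = m) {a b c : E}
    (ha : ∃ m, a * a = ι m) (hb : ∃ m, b * b = ι m) (hc : ∃ m, c * c = ι m)
    (hab : ∃ m, b * (a * b) = ι m * (a * (b * a))) (hbc : ∃ m, c * (b * c) = ι m * (b * (c * b)))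
    (hac : c * a = a * c) : ∃ α β γ, IsCoxeterTriple (ι α * a) (ι β * b) (ι γ * c) := by
  have scale {x : E} (hx : ∃ m, x * x = ι m) : ∃ n, ι n * x * (ι n * x) = 1 := by
    obtain ⟨m, hm⟩ := hx
    obtain ⟨n, hn⟩ := hM m⁻¹
    exact ⟨n, by rw [mul_mul_mul_self_of_central (hι n), hm, ← map_mul, hn, ← map_mul,
      inv_mul_cancel, map_one]⟩
  have triple (m n k : M) (x y z : E) :
      ι m * x * (ι n * y * (ι k * z)) = ι (m * n * k) * (x * (y * z)) := by
    rw [map_mul, map_mul, mul_assoc _ x, ← mul_assoc x, ← mul_assoc x, hι n x, mul_assoc (ι n),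
      mul_assoc (ι n), ← mul_assoc (x * y), hι k]
    simp only [mul_assoc]
  have braid {x y : E} (m n : M) (h : ∃ k, y * (x * y) = ι k * (x * (y * x))) :
      ∃ k, ι n * y * (ι m * x * (ι n * y)) = ι k * (ι m * x * (ι n * y * (ι m * x))) := by
    obtain ⟨k, hk⟩ := h
    refine ⟨n * m⁻¹ * k, ?_⟩
    rw [triple, triple, hk, ← mul_assoc _ (ι k), ← mul_assoc _ (ι (m * n * m)), ← map_mul,
      ← map_mul]
    congr 2
    simp [mul_comm, mul_left_comm]
  obtain ⟨α, hα⟩ := scale ha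
  obtain ⟨β, hβ⟩ := scale hb
  obtain ⟨γ, hγ⟩ := scale hc
  obtain ⟨β', γ', h⟩ := exists_isCoxeterTriple_of_involutions hι hα hβ hγ (braid α β hab)
    (braid β γ hbc) (by
      rw [mul_assoc, ← mul_assoc c, hι α c, mul_assoc, hac, ← mul_assoc, ← map_mul, mul_assoc (ι α),
        ← mul_assoc a, hι γ a, mul_assoc, ← mul_assoc (ι α), ← map_mul, mul_comm])
  exact ⟨α, β' * β, γ' * γ, by simpa only [map_mul, mul_assoc] using h⟩

end CentralScaling

section CommutatorPairing

open groupCohomology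

variable {G A : Type} [Group G] [AddCommGroup A]

/-- The antisymmetrization `f (s, t) - f (t, s)` of 2-cocycles `f` with trivial coefficients. -/
def cocycles₂Commutator (s t : G) : cocycles₂ (Rep.trivial ℤ G A) →+ A where
  toFun f := (f (s, t) : A) - f (t, s)
  map_zero' := sub_self (0 : A)
  map_add' f f' := add_sub_add_comm (f (s, t) : A) (f' (s, t)) (f (t, s)) (f' (t, s))

theorem cocycles₂Commutator_apply (s t : G) (f : cocycles₂ (Rep.trivial ℤ G A)) :
    cocycles₂Commutator s t f = (f (s, t) : A) - f (t, s) := rfl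

theorem CocycleExtension.mul_eq_commutator_mul {f : cocycles₂ (Rep.trivial ℤ G A)}
    {x y : CocycleExtension f} (h : x.right * y.right = y.right * x.right) :
    x * y = inl f (.ofAdd (cocycles₂Commutator x.right y.right f)) * (y * x) := by
  rw [inl_mul]
  ext
  · simp only [mul_left, cocycles₂Commutator_apply, toAdd_ofAdd]
    abel
  · exact h

theorem cocycles₂Commutator_add_self {s t : G} (hs : s * s = 1) (hst : s * t = t * s)
    (f : cocycles₂ (Rep.trivial ℤ G A)) :
    cocycles₂Commutator s t f + cocycles₂Commutator s t f = 0 := by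
  let x : CocycleExtension f := ⟨0, s⟩
  let y : CocycleExtension f := ⟨0, t⟩
  set z := CocycleExtension.inl f (.ofAdd (cocycles₂Commutator s t f)) with hz
  have hxz : x * z = z * x := CocycleExtension.mul_inl _ x
  have hxy : x * y = z * (y * x) := CocycleExtension.mul_eq_commutator_mul hst
  obtain ⟨m, hm⟩ : ∃ m, CocycleExtension.inl f m * 1 = x * x :=
    CocycleExtension.exists_inl_mul_eq hs
  have h1 : x * (x * y) = z * z * (y * (x * x)) := by
    rw [hxy, ← mul_assoc x z, hxz, mul_assoc, ← mul_assoc x y, hxy]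
    simp only [mul_assoc]
  have h2 : x * (x * y) = y * (x * x) := by
    rw [← mul_assoc, ← hm, mul_one, CocycleExtension.mul_inl]
  have h3 : z * z = 1 := by
    rw [h2] at h1
    exact right_eq_mul.1 h1
  rw [hz, ← map_mul, ← ofAdd_add] at h3
  exact CocycleExtension.inl_injective (h3.trans (map_one _).symm)

theorem cocycles₂Commutator_eq_zero {s t : G} (hst : s * t = t * s)
    {f : cocycles₂ (Rep.trivial ℤ G A)} (hf : ⇑f ∈ coboundaries₂ (Rep.trivial ℤ G A)) :
    cocycles₂Commutator s t f = 0 := by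
  obtain ⟨u, hu⟩ := hf
  rw [cocycles₂Commutator_apply, ← hu]
  change (u t - u (s * t) + u s : A) - (u s - u (t * s) + u t) = 0
  rw [hst]
  abel

end CommutatorPairing

section SymmetricGroupFour

open groupCohomology Equiv

variable {A : Type} [AddCommGroup A]

/-- With divisible coefficients, a 2-cocycle of the symmetric group on four letters is determined
up to coboundaries by the commutator of two disjoint transpositions. -/
theorem mem_coboundaries₂_of_cocycles₂Commutator_eq_zero (hA : ∀ a : A, ∃ b, b + b = a)
    {f : cocycles₂ (Rep.trivial ℤ (Perm (Fin 4)) A)}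
    (hf : cocycles₂Commutator (swap 2 3) (swap 0 1) f = 0) :
    ⇑f ∈ coboundaries₂ (Rep.trivial ℤ (Perm (Fin 4)) A) := by
  let lift (g : Perm (Fin 4)) : CocycleExtension f := ⟨0, g⟩
  have hS := IsCoxeterTriple.swaps
  have sq {g : Perm (Fin 4)} (hg : g * g = 1) :
      ∃ m, lift g * lift g = CocycleExtension.inl f m := by
    obtain ⟨m, hm⟩ := CocycleExtension.exists_inl_mul_eq
      (show (lift g * lift g).right = (1 : CocycleExtension f).right from hg)
    exact ⟨m, by rw [← hm, mul_one]⟩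
  have braid {x y : CocycleExtension f} (h : x.right = y.right) :
      ∃ m, x = CocycleExtension.inl f m * y :=
    (CocycleExtension.exists_inl_mul_eq h).imp fun _ => Eq.symm
  obtain ⟨α, β, γ, h⟩ := exists_isCoxeterTriple_of_central (ι := CocycleExtension.inl f)
    CocycleExtension.mul_inl (fun m => (hA m.toAdd).imp fun _ => id)
    (sq hS.mul_self_left) (sq hS.mul_self_mid) (sq hS.mul_self_right)
    (braid hS.braid_left) (braid hS.braid_right)
    (by
      have := CocycleExtension.mul_eq_commutator_mul
        (x := lift (swap 2 3)) (y := lift (swap 0 1)) hS.comm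
      rwa [show cocycles₂Commutator (lift (swap 2 3)).right (lift (swap 0 1)).right f = 0 from hf,
        ofAdd_zero, map_one, one_mul] at this)
  obtain ⟨φ, ha, hb, hc⟩ := h.exists_monoidHom
  refine CocycleExtension.mem_coboundaries₂_of_section φ
    (MonoidHom.eq_of_eqOn_dense closure_swaps_fin_four ?_)
  have hr (m : Multiplicative A) (g : Perm (Fin 4)) :
      CocycleExtension.rightHom (CocycleExtension.inl f m * lift g) = g := one_mul g
  rintro g (rfl | rfl | rfl)
  · exact (congrArg _ ha).trans (hr ..)
  · exact (congrArg _ hb).trans (hr ..)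
  · exact (congrArg _ hc).trans (hr ..)

end SymmetricGroupFour

section PulledBackExtension

open groupCohomology

variable {G A E : Type} [Group G] [AddCommGroup A] [Group E]

/-- The pullback of a central extension `Z → E → E ⧸ Z` along `φ : G →* E ⧸ Z`, pushed out along
`χ : Z →* A`, is given by a 2-cocycle, whose commutator pairing is computed by commutators
in `E`. -/
theorem exists_cocycles₂_of_central (Z : Subgroup E) [Z.Normal] (hZ : ∀ z ∈ Z, ∀ x, x * z = z * x)
    (χ : Z →* Multiplicative A) (φ : G →* E ⧸ Z) :
    ∃ f : cocycles₂ (Rep.trivial ℤ G A), ∀ (s t : G) (x y : E) (z : Z), s * t = t * s →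
      (x : E ⧸ Z) = φ s → (y : E ⧸ Z) = φ t → x * y = z * (y * x) →
      cocycles₂Commutator s t f = (χ z).toAdd := by
  choose σ hσ using fun g => QuotientGroup.mk_surjective (φ g)
  have hζ (g h : G) : ∃ z : Z, σ g * σ h = z * σ (g * h) := by
    have : ((σ g * σ h * (σ (g * h))⁻¹ : E) : E ⧸ Z) = 1 := by
      simp [hσ]
    exact ⟨⟨_, (QuotientGroup.eq_one_iff _).1 this⟩, by simp⟩
  choose ζ hζ using hζ
  have hcomm (z : Z) (x : E) : x * z = z * x := hZ z z.2 x
  have hcocycle (g h j : G) : ζ (g * h) j * ζ g h = ζ h j * ζ g (h * j) := by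
    have h1 : σ g * σ h * σ j = ζ g h * ζ (g * h) j * σ (g * h * j) := by
      rw [hζ, mul_assoc, hζ, ← mul_assoc, mul_assoc g]
    have h2 : σ g * (σ h * σ j) = ζ h j * ζ g (h * j) * σ (g * (h * j)) := by
      rw [hζ, ← mul_assoc, hcomm, mul_assoc, hζ, mul_assoc]
    rw [mul_assoc, h2, mul_assoc g h j] at h1
    exact Subtype.ext (((hcomm _ _).trans (mul_right_cancel h1).symm))
  refine ⟨⟨fun p => (χ (ζ p.1 p.2)).toAdd, (mem_cocycles₂_iff _).2 fun g h j => ?_⟩, ?_⟩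
  · change (χ (ζ (g * h) j)).toAdd + (χ (ζ g h)).toAdd =
      (χ (ζ h j)).toAdd + (χ (ζ g (h * j))).toAdd
    rw [← toAdd_mul, ← toAdd_mul, ← map_mul, ← map_mul, hcocycle]
  · intro s t x y z hst hx hy hxy
    have lift {g : G} {w : E} (hw : (w : E ⧸ Z) = φ g) : ∃ u : Z, σ g = u * w := by
      have : ((σ g * w⁻¹ : E) : E ⧸ Z) = 1 := by simp [hσ, hw]
      exact ⟨⟨_, (QuotientGroup.eq_one_iff _).1 this⟩, by simp⟩
    obtain ⟨u, hu⟩ := lift hx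
    obtain ⟨v, hv⟩ := lift hy
    have hσst : σ s * σ t = z * (σ t * σ s) := by
      have h1 (m n : Z) (p q : E) : m * p * (n * q) = m * n * (p * q) := by
        rw [mul_assoc, ← mul_assoc p, hcomm]
        simp only [mul_assoc]
      rw [hu, hv, h1, h1, hxy, ← mul_assoc, hcomm, ← mul_assoc (z : E), ← hcomm v u]
      simp only [mul_assoc]
    have : ζ s t = z * ζ t s := by
      rw [hζ, hζ, hst, ← mul_assoc] at hσst
      exact Subtype.ext (mul_right_cancel hσst)
    change (χ (ζ s t)).toAdd - (χ (ζ t s)).toAdd = _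
    rw [this, map_mul, toAdd_mul, add_sub_cancel_right]

end PulledBackExtension

section BinaryExtension

open groupCohomology Equiv

/-- The subgroup `{1, -1}` of the group of units of a ring. -/
def signSubgroup (R : Type*) [Ring R] : Subgroup Rˣ where
  carrier := {1, -1}
  one_mem' := Or.inl rfl
  mul_mem' := by
    rintro _ _ (rfl | rfl) (rfl | rfl) <;> simp
  inv_mem' := by
    rintro _ (rfl | rfl) <;> simp

theorem signSubgroup_central {R : Type*} [Ring R] {z : Rˣ} (hz : z ∈ signSubgroup R) (x : Rˣ) :
    x * z = z * x := by
  rcases hz with rfl | rfl <;> simp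

instance (R : Type*) [Ring R] : (signSubgroup R).Normal :=
  ⟨fun z hz x => by rwa [signSubgroup_central hz, mul_inv_cancel_right]⟩

open Classical in
/-- The homomorphism `{1, -1} → A` sending `-1` to a given element `a` with `a + a = 0`. -/
noncomputable def signSubgroupHom {R A : Type*} [Ring R] [AddCommGroup A] (hR : (-1 : Rˣ) ≠ 1)
    {a : A} (ha : a + a = 0) : signSubgroup R →* Multiplicative A where
  toFun z := if (z : Rˣ) = 1 then 1 else .ofAdd a
  map_one' := by simp
  map_mul' := by
    rintro ⟨_, rfl | rfl⟩ ⟨_, rfl | rfl⟩ <;> simp [hR, ← ofAdd_add, ha]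

/-- A Coxeter triple in `PGL₂(𝔽₃)` whose commuting members have anticommuting lifts to
`GL₂(𝔽₃)`. -/
theorem exists_isCoxeterTriple_quotient_signSubgroup :
    ∃ a b c : (Matrix (Fin 2) (Fin 2) (ZMod 3))ˣ,
      IsCoxeterTriple (a : _ ⧸ signSubgroup (Matrix (Fin 2) (Fin 2) (ZMod 3))) b c ∧
        c * a = -1 * (a * c) := by
  let a : (Matrix (Fin 2) (Fin 2) (ZMod 3))ˣ :=
    ⟨!![1, 0; 0, -1], !![1, 0; 0, -1], by decide, by decide⟩
  let b : (Matrix (Fin 2) (Fin 2) (ZMod 3))ˣ :=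
    ⟨!![1, 1; 0, -1], !![1, 1; 0, -1], by decide, by decide⟩
  let c : (Matrix (Fin 2) (Fin 2) (ZMod 3))ˣ :=
    ⟨!![0, 1; 1, 0], !![0, 1; 1, 0], by decide, by decide⟩
  have key {x y : (Matrix (Fin 2) (Fin 2) (ZMod 3))ˣ} (h : x.val = y.val ∨ x.val = -y.val) :
      (x : _ ⧸ signSubgroup (Matrix (Fin 2) (Fin 2) (ZMod 3))) = y := by
    refine QuotientGroup.eq.2 ?_
    rcases h with h | h
    · rw [Units.ext h, inv_mul_cancel]
      exact Or.inl rfl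
    · rw [show x = -y from Units.ext h]
      exact Or.inr (by simp)
  exact ⟨a, b, c, ⟨key (by decide), key (by decide), key (by decide), key (by decide),
    key (by decide), key (by decide)⟩, Units.ext (by decide)⟩

/-- Every 2-torsion element is the commutator of two disjoint transpositions for some 2-cocycle of
the symmetric group on four letters. -/
theorem exists_cocycles₂Commutator_eq {A : Type} [AddCommGroup A] {a : A} (ha : a + a = 0) :
    ∃ f : cocycles₂ (Rep.trivial ℤ (Perm (Fin 4)) A),
      cocycles₂Commutator (swap 2 3) (swap 0 1) f = a := by
  obtain ⟨x, y, z, h, hxz⟩ := exists_isCoxeterTriple_quotient_signSubgroup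
  obtain ⟨φ, hx, -, hz⟩ := h.exists_monoidHom
  have hR : (-1 : (Matrix (Fin 2) (Fin 2) (ZMod 3))ˣ) ≠ 1 :=
    fun h => absurd (congrArg Units.val h) (by decide)
  obtain ⟨f, hf⟩ := exists_cocycles₂_of_central _ (fun _ => signSubgroup_central)
    (signSubgroupHom hR ha) φ
  refine ⟨f, (hf _ _ z x ⟨-1, Or.inr rfl⟩ (by decide) hz.symm hx.symm hxz).trans ?_⟩
  exact congrArg Multiplicative.toAdd (if_neg hR)

end BinaryExtension

section SecondCohomology

open groupCohomology Equiv

theorem AddSubgroup.mem_torsionBy_two {A : Type*} [AddCommGroup A] (a : A) :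
    a ∈ AddSubgroup.torsionBy A 2 ↔ a + a = 0 :=
  (Submodule.mem_torsionBy_iff (2 : ℤ) a).trans (by rw [two_smul])

/-- For a divisible group `A`, `H²(𝒮₄, A)` is isomorphic to the 2-torsion of `A`. -/
theorem nonempty_H2_addEquiv_torsion {A : Type} [AddCommGroup A] (hA : ∀ a : A, ∃ b, b + b = a) :
    Nonempty (H2 (Rep.trivial ℤ (Perm (Fin 4)) A) ≃+ AddSubgroup.torsionBy A 2) := by
  let P : cocycles₂ (Rep.trivial ℤ (Perm (Fin 4)) A) →+ A :=
    cocycles₂Commutator (swap 2 3) (swap 0 1)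
  let q : cocycles₂ (Rep.trivial ℤ (Perm (Fin 4)) A) →+ H2 (Rep.trivial ℤ (Perm (Fin 4)) A) :=
    (H2π (Rep.trivial ℤ (Perm (Fin 4)) A)).hom.toAddMonoidHom
  have hq : Function.Surjective q := (ModuleCat.epi_iff_surjective _).1 inferInstance
  have hker : q.ker = P.ker := by
    ext f
    exact (H2π_eq_zero_iff f).trans ⟨cocycles₂Commutator_eq_zero IsCoxeterTriple.swaps.comm,
      mem_coboundaries₂_of_cocycles₂Commutator_eq_zero hA⟩
  have hrange : P.range = AddSubgroup.torsionBy A 2 := by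
    ext a
    refine Iff.trans ?_ (AddSubgroup.mem_torsionBy_two a).symm
    refine ⟨?_, fun ha => exists_cocycles₂Commutator_eq ha⟩
    rintro ⟨f, rfl⟩
    exact cocycles₂Commutator_add_self IsCoxeterTriple.swaps.mul_self_right
      IsCoxeterTriple.swaps.comm f
  exact ⟨(QuotientAddGroup.quotientKerEquivOfSurjective q hq).symm.trans <|
    (QuotientAddGroup.quotientAddEquivOfEq hker).trans <|
    (QuotientAddGroup.quotientKerEquivRange P).trans (AddEquiv.addSubgroupCongr hrange)⟩

end SecondCohomology

section RationalCoefficients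

open CategoryTheory groupCohomology

universe w u v

theorem Rep.exact_of_forall_exists {k : Type u} {G : Type v} [CommRing k] [Group G]
    (S : ShortComplex (Rep.{w} k G)) (h : ∀ x : S.X₂, S.g.hom x = 0 → ∃ y : S.X₁, S.f.hom y = x) :
    S.Exact :=
  (forget₂ (Rep.{w} k G) (ModuleCat k)).reflects_exact_of_faithful _ <|
    (ShortComplex.moduleCat_exact_iff _).2 h

variable (G : Type) [Group G]

/-- A finite group has no cohomology in positive degrees with rational coefficients. -/
theorem isZero_groupCohomology_rat [Finite G] (n : ℕ) :
    Limits.IsZero (groupCohomology (Rep.trivial ℤ G ℚ) (n + 1)) := by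
  have := Fintype.ofFinite G
  let S : Subgroup G := ⊥
  let C := Rep.coind S.subtype (Rep.trivial ℤ S ℚ)
  have hC : Limits.IsZero (groupCohomology C (n + 1)) :=
    (isZero_groupCohomology_succ_of_subsingleton _ n).of_iso (coindIso _ _)
  let i : Rep.trivial ℤ G ℚ ⟶ C := Rep.ofHom
    { toFun := fun q => ⟨fun _ => q, fun _ _ => rfl⟩
      map_add' := fun _ _ => rfl
      map_smul' := fun _ _ => rfl
      isIntertwining' := fun _ => rfl }
  let r : C ⟶ Rep.trivial ℤ G ℚ := Rep.ofHom
    { toFun := fun f => (∑ x, f.1 x : ℚ) / Fintype.card G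
      map_add' := fun f f' => by
        rw [← add_div, ← Finset.sum_add_distrib]
        rfl
      map_smul' := fun m f => by
        rw [RingHom.id_apply, ← smul_div_assoc, Finset.smul_sum]
        rfl
      isIntertwining' := fun g => by
        ext f
        exact congrArg (fun q : ℚ => q / Fintype.card G)
          (Fintype.sum_equiv (Equiv.mulRight g) _ _ fun _ => rfl) }
  have hir : i ≫ r = 𝟙 _ := by
    ext q
    change (∑ _ : G, (q : ℚ)) / Fintype.card G = q
    rw [Finset.sum_const, Finset.card_univ, nsmul_eq_mul, mul_div_cancel_left₀]
    exact Nat.cast_ne_zero.2 Fintype.card_ne_zero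
  refine (Limits.IsZero.iff_id_eq_zero _).2 ?_
  change 𝟙 ((functor ℤ G (n + 1)).obj (Rep.trivial ℤ G ℚ)) = 0
  have hr : (functor ℤ G (n + 1)).map r = 0 := hC.eq_of_src _ _
  rw [← (functor ℤ G (n + 1)).map_id, ← hir, Functor.map_comp, hr, Limits.comp_zero]

/-- The short exact sequence `ℤ → ℚ → ℚ ⧸ ℤ` of trivial representations. -/
noncomputable def ratModIntShortComplex : ShortComplex (Rep.{0} ℤ G) where
  X₁ := Rep.trivial ℤ G ℤ
  X₂ := Rep.trivial ℤ G ℚ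
  X₃ := Rep.trivial ℤ G (AddCircle (1 : ℚ))
  f := Rep.ofHom
    { (Int.castAddHom ℚ).toIntLinearMap with
      isIntertwining' := fun _ => rfl }
  g := Rep.ofHom
    { (QuotientAddGroup.mk' (AddSubgroup.zmultiples (1 : ℚ))).toIntLinearMap with
      isIntertwining' := fun _ => rfl }
  zero := by
    ext
    exact (AddCircle.coe_eq_zero_iff (1 : ℚ)).2 ⟨1, zsmul_one 1⟩

theorem ratModIntShortComplex_shortExact : (ratModIntShortComplex G).ShortExact where
  mono_f := (Rep.mono_iff_injective _).2 fun _ _ h => Int.cast_injective (α := ℚ) h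
  epi_g := (Rep.epi_iff_surjective _).2 fun x =>
    QuotientAddGroup.mk_surjective (s := AddSubgroup.zmultiples (1 : ℚ)) x
  exact := by
    refine Rep.exact_of_forall_exists _ fun q hq => ?_
    obtain ⟨n, hn⟩ := (AddCircle.coe_eq_zero_iff (1 : ℚ)).1 hq
    exact ⟨n, by rw [← hn, zsmul_one]; rfl⟩

/-- For a finite group `G`, the connecting homomorphism identifies `Hⁿ⁺¹(G, ℚ ⧸ ℤ)` with
`Hⁿ⁺²(G, ℤ)`. -/
noncomputable def groupCohomologyRatModIntEquiv [Finite G] (n : ℕ) :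
    groupCohomology (Rep.trivial ℤ G (AddCircle (1 : ℚ))) (n + 1) ≃+
      groupCohomology (Rep.trivial ℤ G ℤ) (n + 2) :=
  have := isIso_δ_of_isZero (ratModIntShortComplex_shortExact G) (n + 1)
    (isZero_groupCohomology_rat G n) (isZero_groupCohomology_rat G (n + 1))
  (asIso (δ (ratModIntShortComplex_shortExact G) (n + 1) (n + 2) rfl)).toLinearEquiv.toAddEquiv

end RationalCoefficients

theorem exists_add_self_eq_addCircle_rat (a : AddCircle (1 : ℚ)) : ∃ b, b + b = a := by
  obtain ⟨q, rfl⟩ := QuotientAddGroup.mk_surjective a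
  exact ⟨((q / 2 : ℚ) : AddCircle (1 : ℚ)), by rw [← AddCircle.coe_add, add_halves]⟩

theorem card_torsionBy_two_addCircle_rat :
    Nat.card (AddSubgroup.torsionBy (AddCircle (1 : ℚ)) 2) = 2 := by
  have h2 : ((1 / 2 : ℚ) : AddCircle (1 : ℚ)) + (1 / 2 : ℚ) = 0 := by
    rw [← AddCircle.coe_add, add_halves, AddCircle.coe_period]
  refine Nat.card_eq_two_iff.2
    ⟨0, ⟨_, (AddSubgroup.mem_torsionBy_two _).2 h2⟩, fun h => ?_, Set.eq_univ_of_forall ?_⟩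
  · obtain ⟨n, hn⟩ := (AddCircle.coe_eq_zero_iff (1 : ℚ)).1 (congrArg Subtype.val h).symm
    rw [zsmul_one, eq_div_iff two_ne_zero] at hn
    norm_cast at hn
    lia
  · rintro ⟨a, ha⟩
    obtain ⟨q, rfl⟩ := QuotientAddGroup.mk_surjective a
    obtain ⟨n, hn⟩ := (AddCircle.coe_eq_zero_iff (1 : ℚ)).1 ((AddSubgroup.mem_torsionBy_two _).1 ha)
    rw [zsmul_one] at hn
    obtain ⟨m, rfl | rfl⟩ := n.even_or_odd'
    · refine Or.inl (Subtype.ext ((AddCircle.coe_eq_zero_iff (1 : ℚ)).2 ⟨m, ?_⟩))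
      push_cast at hn
      rw [zsmul_one]
      linarith
    · refine Or.inr (Subtype.ext (sub_eq_zero.1 ((AddCircle.coe_eq_zero_iff (1 : ℚ)
        (x := q - 1 / 2)).2 ⟨m, ?_⟩)))
      push_cast at hn
      rw [zsmul_one]
      linarith

/-- `H³(𝒮₄, ℤ) ≅ ℤ/2ℤ`. -/
theorem groupCohomology_three_symmetricGroupFour :
    Nonempty
      ((groupCohomology (Rep.trivial ℤ (Equiv.Perm (Fin 4)) ℤ) 3) ≃+ ZMod 2) := by
  obtain ⟨e⟩ := nonempty_H2_addEquiv_torsion exists_add_self_eq_addCircle_rat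
  have := isAddCyclic_of_prime_card card_torsionBy_two_addCircle_rat
  exact ⟨(groupCohomologyRatModIntEquiv (Equiv.Perm (Fin 4)) 1).symm.trans <| e.trans <|
    (zmodAddCyclicAddEquiv this).symm.trans
      (ZMod.ringEquivCongr card_torsionBy_two_addCircle_rat).toAddEquiv⟩
end

section
/- Let G = L₂(7) = PSL(2, 𝔽₇) be the projective special linear group over the field with seven elements, i.e. the quotient of SL(2, ℤ/7ℤ) by its center. Then the third group cohomology of G with coefficients in ℤ with the trivial G-action satisfies H³(L₂(7), ℤ) ≅ ℤ/2ℤ. -/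
section TorusRelations

variable {E : Type*} [Group E] {U D W : E}

/-- Relations between lifts of a unipotent element, a torus element of order three and the Weyl
element of `SL(2, 7)` which bound the group they generate. -/
structure TorusRelations (U D W : E) : Prop where
  U_pow : U ^ 7 = 1
  D_pow : D ^ 3 = 1
  D_U : D * U = U ^ 4 * D
  W_D : W * D = D⁻¹ * W
  WW_U : W * W * U = U * (W * W)
  W_U₁ : W = U * (W * U * W⁻¹) * U
  W_U₄ : D * W = U ^ 2 * (W * U * W⁻¹) ^ 4 * U ^ 2
  W_U₂ : D ^ 2 * W = U ^ 4 * (W * U * W⁻¹) ^ 2 * U ^ 4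

namespace TorusRelations

variable (r : TorusRelations U D W)
include r

lemma W_D' : W * D = D * (D * W) := by
  rw [r.W_D, inv_eq_of_mul_eq_one_right (b := D * D) (by rw [← r.D_pow, pow_three]), mul_assoc]

lemma U_inv (a b : ℕ) (h : a + b = 7) : (U ^ a)⁻¹ = U ^ b :=
  inv_eq_of_mul_eq_one_right (by rw [← pow_add, h, r.U_pow])

lemma WW_D : W * W * D = D * (W * W) := by
  have h := r.W_D
  have : W * D⁻¹ = D * W := by
    rw [mul_inv_eq_iff_eq_mul, mul_assoc, h, mul_inv_cancel_left]
  rw [mul_assoc, h, ← mul_assoc, this, mul_assoc]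

lemma W_U_W {n a i b : ℕ} (h : D ^ i * W = U ^ a * (W * U * W⁻¹) ^ n * U ^ a) (hab : a + b = 7) :
    W * U ^ n * W = W * W * (U ^ b * (D ^ i * W) * U ^ b) := by
  have hc : Commute (W * W) (U ^ b) := (show Commute (W * W) U from r.WW_U).pow_right b
  have : W * U ^ n * W⁻¹ = U ^ b * (D ^ i * W) * U ^ b := by
    rw [h, ← r.U_inv a b hab, ← conj_pow]; group
  calc W * U ^ n * W = (W * U ^ n * W⁻¹) * (W * W) := by group
    _ = U ^ b * (D ^ i * (W * W)) * W * U ^ b := by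
      rw [this, mul_assoc _ (U ^ b), ← hc.eq]; group
    _ = U ^ b * (W * W) * (D ^ i * W) * U ^ b := by
      rw [← ((show Commute (W * W) D from r.WW_D).pow_right i).eq]; group
    _ = _ := by rw [← hc.eq]; group

lemma W_D_pow (i : ℕ) : W * D ^ i = (D ^ i)⁻¹ * W := by
  have : SemiconjBy W D D⁻¹ := r.W_D
  simpa using (this.pow_right i).eq

lemma W_U_W_inv {n m a i : ℕ} (h : D ^ i * W = U ^ a * (W * U * W⁻¹) ^ n * U ^ a)
    (hnm : n + m = 7) : W * U ^ m * W = U ^ a * (D ^ i * W) * U ^ a := by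
  have hc : Commute (W * W) (U ^ a) := (show Commute (W * W) U from r.WW_U).pow_right a
  have e : (D ^ i * W)⁻¹ = (U ^ a)⁻¹ * (W * U ^ m * W⁻¹) * (U ^ a)⁻¹ := by
    rw [h, ← r.U_inv n m hnm, conj_pow]; group
  have e' : W * U ^ m * W⁻¹ = U ^ a * (D ^ i * W)⁻¹ * U ^ a := by rw [e]; group
  calc W * U ^ m * W = (W * U ^ m * W⁻¹) * (W * W) := by group
    _ = U ^ a * (D ^ i * W)⁻¹ * (W * W) * U ^ a := by
      rw [e', mul_assoc _ (U ^ a), ← hc.eq]; group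
    _ = U ^ a * (W⁻¹ * ((D ^ i)⁻¹ * W) * W) * U ^ a := by group
    _ = _ := by rw [← r.W_D_pow]; group

lemma D_U_pow (n : ℕ) : D * U ^ n = U ^ (4 * n) * D := by
  have : SemiconjBy D U (U ^ 4) := r.D_U
  rw [(this.pow_right n).eq, pow_mul]

lemma D_pow_U_pow (i n : ℕ) : D ^ i * U ^ n = U ^ (4 ^ i * n) * D ^ i := by
  induction i generalizing n with
  | zero => simp
  | succ i ih =>
    rw [pow_succ, mul_assoc, r.D_U_pow, ← mul_assoc, ih, mul_assoc, pow_succ, mul_assoc]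

lemma U_pow_mod (n : ℕ) : U ^ n = U ^ (n % 7) := pow_eq_pow_mod n r.U_pow

lemma W_pow_four : W ^ 4 = 1 := by
  have h₁ : W * U ^ 1 * W = W * W * (U ^ 6 * (D ^ 0 * W) * U ^ 6) :=
    r.W_U_W (a := 1) (by simpa using r.W_U₁) rfl
  have h₃ : W * U ^ 3 * W = U ^ 2 * (D ^ 1 * W) * U ^ 2 :=
    r.W_U_W_inv (n := 4) (by simpa using r.W_U₄) rfl
  have h₅ : W * U ^ 5 * W = U ^ 4 * (D ^ 2 * W) * U ^ 4 :=
    r.W_U_W_inv (n := 2) r.W_U₂ rfl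
  have e₁ : (W * U ^ 5 * W) * (W * W)⁻¹ * (W * U ^ 3 * W) = W * U ^ 1 * W := by
    rw [show U ^ 1 = U ^ 5 * U ^ 3 by rw [← pow_add, r.U_pow_mod (5 + 3)]]
    group
  have e₂ : (W * U ^ 5 * W) * (W * U ^ 3 * W) = (W * W) * (W * U ^ 1 * W) := by
    have hc : Commute (W * W) (W * U ^ 5 * W) := by
      have : Commute (W * W) W := by simp [Commute, SemiconjBy, mul_assoc]
      exact (this.mul_right ((show Commute (W * W) U from r.WW_U).pow_right 5)).mul_right this
    rw [← e₁, mul_assoc (W * U ^ 5 * W), ← mul_assoc (W * W), hc.eq, mul_assoc (W * U ^ 5 * W),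
      mul_inv_cancel_left]
  have e₃ : (W * U ^ 5 * W) * (W * U ^ 3 * W) = U ^ 6 * W * U ^ 6 := by
    calc _ = U ^ 4 * D ^ 2 * W * (U ^ 6 * D ^ 1) * W * U ^ 2 := by rw [h₅, h₃]; group
      _ = U ^ 4 * D ^ 2 * (W * D) * U ^ 5 * W * U ^ 2 := by
        rw [r.U_pow_mod 6, show 6 % 7 = (4 ^ 1 * 5) % 7 from rfl, ← r.U_pow_mod,
          ← r.D_pow_U_pow]; group
      _ = U ^ 4 * D ^ (3 + 1) * (W * U ^ 5 * W) * U ^ 2 := by rw [r.W_D']; group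
      _ = U ^ 4 * (D ^ 1 * U ^ 4) * D ^ 2 * W * U ^ 4 * U ^ 2 := by
        rw [h₅, pow_add, r.D_pow]; group
      _ = U ^ (7 + 7 + 6) * D ^ 3 * W * U ^ 6 := by rw [r.D_pow_U_pow]; group
      _ = _ := by rw [r.D_pow, pow_add, pow_add, r.U_pow]; group
  rw [e₂, h₁] at e₃
  have : W * W * (W * W) * (U ^ 6 * W * U ^ 6) = U ^ 6 * W * U ^ 6 := by
    rw [pow_zero, one_mul, ← mul_assoc] at e₃
    exact e₃
  rw [← mul_eq_right.1 this]
  simp only [pow_succ, pow_zero, one_mul, mul_assoc]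

/-- Words representing elements of the Borel subgroup. -/
def IsBorel (U D W x : E) : Prop := ∃ a i j : ℕ, x = U ^ a * D ^ i * (W * W) ^ j

/-- Words representing elements of the Borel subgroup or of the big Bruhat cell. -/
def IsBruhat (U D W x : E) : Prop :=
  IsBorel U D W x ∨ ∃ y b, IsBorel U D W y ∧ x = y * W * U ^ b

lemma isBorel_mul {x y : E} (hx : IsBorel U D W x) (hy : IsBorel U D W y) :
    IsBorel U D W (x * y) := by
  obtain ⟨a, i, j, rfl⟩ := hx
  obtain ⟨b, k, l, rfl⟩ := hy
  refine ⟨a + 4 ^ i * b, i + k, j + l, ?_⟩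
  have hU : Commute ((W * W) ^ j) (U ^ b) := (show Commute (W * W) U from r.WW_U).pow_pow j b
  have hD : Commute ((W * W) ^ j) (D ^ k) := (show Commute (W * W) D from r.WW_D).pow_pow j k
  calc _ = U ^ a * D ^ i * ((W * W) ^ j * (U ^ b * D ^ k)) * (W * W) ^ l := by group
    _ = U ^ a * (D ^ i * U ^ b) * D ^ k * (W * W) ^ j * (W * W) ^ l := by
      rw [(hU.mul_right hD).eq]; simp only [mul_assoc]
    _ = _ := by rw [r.D_pow_U_pow]; simp only [pow_add, mul_assoc]

omit r in
lemma isBorel_WW : IsBorel U D W (W * W) := ⟨0, 0, 1, by simp⟩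

omit r in
lemma isBorel_U_D (a i : ℕ) : IsBorel U D W (U ^ a * D ^ i) := ⟨a, i, 0, by simp⟩

lemma W_U_W_mem (b : ℕ) : IsBruhat U D W (W * U ^ b * W) := by
  have key {n a c i : ℕ} (h : D ^ i * W = U ^ a * (W * U * W⁻¹) ^ n * U ^ a)
      (hab : a + c = 7) : IsBruhat U D W (W * U ^ n * W) :=
    .inr ⟨_, c, r.isBorel_mul isBorel_WW (isBorel_U_D c i), by
      rw [r.W_U_W h hab]; simp only [mul_assoc]⟩
  have key' {n m a i : ℕ} (h : D ^ i * W = U ^ a * (W * U * W⁻¹) ^ n * U ^ a)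
      (hnm : n + m = 7) : IsBruhat U D W (W * U ^ m * W) :=
    .inr ⟨_, a, isBorel_U_D a i, by
      rw [r.W_U_W_inv h hnm]; simp only [mul_assoc]⟩
  have h₁ : D ^ 0 * W = U ^ 1 * (W * U * W⁻¹) ^ 1 * U ^ 1 := by simpa using r.W_U₁
  have h₄ : D ^ 1 * W = U ^ 2 * (W * U * W⁻¹) ^ 4 * U ^ 2 := by simpa using r.W_U₄
  have h₂ := r.W_U₂
  rw [r.U_pow_mod b]
  have := Nat.mod_lt b (show 7 > 0 by norm_num)
  interval_cases b % 7
  · exact .inl (by simpa using isBorel_WW)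
  · exact key h₁ (c := 6) rfl
  · exact key h₂ (c := 3) rfl
  · exact key' h₄ rfl
  · exact key h₄ (c := 5) rfl
  · exact key' h₂ rfl
  · exact key' h₁ rfl

lemma isBruhat_mul_U {x : E} (hx : IsBruhat U D W x) : IsBruhat U D W (x * U) := by
  obtain hx | ⟨y, b, hy, rfl⟩ := hx
  · exact .inl (r.isBorel_mul hx (by simpa using isBorel_U_D (D := D) (U := U) (W := W) 1 0))
  · exact .inr ⟨y, b + 1, hy, by rw [pow_succ, mul_assoc]⟩

lemma isBruhat_mul_W {x : E} (hx : IsBruhat U D W x) : IsBruhat U D W (x * W) := by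
  obtain hx | ⟨y, b, hy, rfl⟩ := hx
  · exact .inr ⟨x, 0, hx, by simp⟩
  · rw [mul_assoc, mul_assoc, ← mul_assoc W]
    obtain h | ⟨z, c, hz, h⟩ := r.W_U_W_mem b
    · exact .inl (r.isBorel_mul hy h)
    · exact .inr ⟨y * z, c, r.isBorel_mul hy hz, by rw [h]; simp only [mul_assoc]⟩

lemma isBruhat_of_mem_closure {x : E} (hx : x ∈ Subgroup.closure {U, W}) : IsBruhat U D W x := by
  induction hx using Subgroup.closure_induction_right with
  | one => exact .inl ⟨0, 0, 0, by simp⟩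
  | mul_right x hx y hy h =>
    obtain rfl | rfl := hy
    · exact r.isBruhat_mul_U h
    · exact r.isBruhat_mul_W h
  | mul_inv_cancel x hx y hy h =>
    obtain rfl | rfl := hy
    · rw [inv_eq_of_mul_eq_one_right (b := y ^ 6) (by rw [← r.U_pow]; group)]
      simp only [pow_succ, pow_zero, one_mul, ← mul_assoc]
      iterate 6 apply r.isBruhat_mul_U
      exact h
    · rw [inv_eq_of_mul_eq_one_right (b := y ^ 3) (by rw [← r.W_pow_four]; group)]
      simp only [pow_succ, pow_zero, one_mul, ← mul_assoc]
      iterate 3 apply r.isBruhat_mul_W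
      exact h

end TorusRelations

end TorusRelations

namespace SL2F7

open Matrix

/-- The standard upper unipotent element. -/
def u : SpecialLinearGroup (Fin 2) (ZMod 7) := ⟨!![1, 1; 0, 1], by decide⟩

/-- A diagonal element of order six. -/
def h : SpecialLinearGroup (Fin 2) (ZMod 7) := ⟨!![3, 0; 0, 5], by decide⟩

/-- The Weyl element. -/
def w : SpecialLinearGroup (Fin 2) (ZMod 7) := ⟨!![0, 1; -1, 0], by decide⟩

lemma h_mul_u : h * u = u ^ 2 * h := by decide +kernel
lemma w_eq : w * w = u * w * u * w⁻¹ * u * w := by decide +kernel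

lemma borel_eq_one : ∀ (a : Fin 7) (i : Fin 3) (j : Fin 2),
    u ^ a.val * (h ^ 2) ^ i.val * (w * w) ^ j.val = 1 → a = 0 ∧ i = 0 ∧ j = 0 := by
  decide +kernel

lemma bruhat_ne_one : ∀ (a : Fin 7) (i : Fin 3) (j : Fin 2) (b : Fin 7),
    u ^ a.val * (h ^ 2) ^ i.val * (w * w) ^ j.val * w * u ^ b.val ≠ 1 := by
  decide +kernel

lemma closure_u_w : Subgroup.closure {u, w} = ⊤ := by
  have hu : u ∈ Subgroup.closure {u, w} := Subgroup.subset_closure (by simp)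
  have hw : w ∈ Subgroup.closure {u, w} := Subgroup.subset_closure (by simp)
  have key : ∀ a c d : ZMod 7, c ≠ 0 →
      (u ^ ((a - 1) * c⁻¹).val * w * u ^ (-c).val * w ^ 3 * u ^ ((d - 1) * c⁻¹).val).1 =
        !![a, (a * d - 1) * c⁻¹; c, d] := by
    decide +kernel
  have mem (g : SpecialLinearGroup (Fin 2) (ZMod 7)) (hc : g.1 1 0 ≠ 0) :
      g ∈ Subgroup.closure {u, w} := by
    have hdet : g.1 0 0 * g.1 1 1 - g.1 0 1 * g.1 1 0 = 1 := (det_fin_two g.1).symm.trans g.2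
    have hb : (g.1 0 0 * g.1 1 1 - 1) * (g.1 1 0)⁻¹ = g.1 0 1 := by
      have := Fact.mk (show Nat.Prime 7 by norm_num)
      rw [mul_inv_eq_iff_eq_mul₀ hc]
      linear_combination hdet
    have hk := key (g.1 0 0) (g.1 1 0) (g.1 1 1) hc
    rw [hb, ← eta_fin_two] at hk
    rw [← Subtype.ext hk]
    exact mul_mem (mul_mem (mul_mem (mul_mem (pow_mem hu _) hw) (pow_mem hu _))
      (pow_mem hw 3)) (pow_mem hu _)
  rw [eq_top_iff]
  intro g _
  by_cases hc : g.1 1 0 = 0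
  · refine (Subgroup.mul_mem_cancel_right _ hw).1 (mem _ fun h0 => ?_)
    have hd : g.1 1 1 = 0 := by
      simpa [w, mul_apply, Fin.sum_univ_two, hc] using (show (g.1 * w.1) 1 0 = 0 from h0)
    have hdet : g.1 0 0 * g.1 1 1 - g.1 0 1 * g.1 1 0 = 1 := (det_fin_two g.1).symm.trans g.2
    rw [hc, hd, mul_zero, mul_zero, sub_zero] at hdet
    exact absurd hdet (by decide)
  · exact mem g hc

lemma monoidHom_apply_eq_one {M : Type*} [CommGroup M]
    (φ : SpecialLinearGroup (Fin 2) (ZMod 7) →* M) (g) : φ g = 1 := by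
  have hu : φ u = 1 := by
    have := congr_arg φ h_mul_u
    rw [map_mul, map_mul, map_pow, mul_comm, pow_two, mul_left_inj] at this
    exact left_eq_mul.1 this
  have hw : φ w = 1 := by
    have := congr_arg φ w_eq
    simpa [hu] using this
  suffices φ = 1 by simp [this]
  exact MonoidHom.eq_of_eqOn_dense closure_u_w (by rintro _ (rfl | rfl) <;> assumption)

section Extension

variable {E : Type*} [Group E] {p : E →* SpecialLinearGroup (Fin 2) (ZMod 7)}

/-- Lifts `U`, `W`, `H` of `u`, `w`, `h` to a central extension, normalized so that the relations
`h * u = u ^ 2 * h` and `w = u * (w * u * w⁻¹) * u` hold for the lifts. -/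
structure IsLift (p : E →* SpecialLinearGroup (Fin 2) (ZMod 7)) (U W H : E) : Prop where
  central : ∀ k, p k = 1 → ∀ g, k * g = g * k
  map_U : p U = u
  map_W : p W = w
  map_H : p H = h
  H_U : H * U = U ^ 2 * H
  W_eq : W = U * (W * U * W⁻¹) * U

lemma conj_eq_of_map_eq (central : ∀ k, p k = 1 → ∀ g, k * g = g * k) {x y : E}
    (hxy : p x = p y) (g : E) : x * g * x⁻¹ = y * g * y⁻¹ := by
  have hk := central (y⁻¹ * x) (by simp [hxy]) g
  calc _ = y * ((y⁻¹ * x) * g) * x⁻¹ := by group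
    _ = _ := by rw [hk]; group

lemma exists_isLift (central : ∀ k, p k = 1 → ∀ g, k * g = g * k)
    (hp : Function.Surjective p) : ∃ U W H, IsLift p U W H := by
  obtain ⟨U₀, hU₀⟩ := hp u
  obtain ⟨W₀, hW₀⟩ := hp w
  obtain ⟨H, hH⟩ := hp h
  set c := U₀⁻¹ ^ 2 * H * U₀ * H⁻¹ with hc
  have pc : p c = 1 := by
    simp only [hc, map_mul, map_inv, map_pow, hU₀, hH, mul_assoc]
    rw [← mul_assoc h, h_mul_u]; group
  set U := U₀ * c with hU
  have pU : p U = u := by simp [hU, pc, hU₀]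
  have hHU : H * U = U ^ 2 * H := by
    calc H * U = H * U₀ * c := by rw [hU, mul_assoc]
      _ = U₀ ^ 2 * c * (H * c) := by rw [hc]; group
      _ = U₀ ^ 2 * c ^ 2 * H := by rw [← central c pc H, pow_two c]; simp only [mul_assoc]
      _ = U ^ 2 * H := by rw [hU, (show Commute U₀ c from (central c pc U₀).symm).mul_pow]
  set W := U * (W₀ * U * W₀⁻¹) * U with hW
  have pW : p W = w := by
    simp only [hW, map_mul, map_inv, pU, hW₀]
    decide +kernel
  have hV : W * U * W⁻¹ = W₀ * U * W₀⁻¹ := conj_eq_of_map_eq central (by rw [pW, hW₀]) U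
  exact ⟨U, W, H, central, pU, pW, hH, hHU, by rw [hV]⟩

namespace IsLift

variable {U W H : E} (l : IsLift p U W H)
include l

lemma commute_of_commute {x : E} (hU : Commute x U) (hW : Commute x W) (g : E) : Commute x g := by
  have : (Subgroup.centralizer {x}).map p = ⊤ := by
    rw [eq_top_iff, ← closure_u_w, Subgroup.closure_le]
    rintro _ (rfl | rfl)
    · exact ⟨U, Subgroup.mem_centralizer_singleton_iff.2 hU.eq.symm, l.map_U⟩
    · exact ⟨W, Subgroup.mem_centralizer_singleton_iff.2 hW.eq.symm, l.map_W⟩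
  obtain ⟨y, hy, hyg⟩ : p g ∈ (Subgroup.centralizer {x}).map p := this ▸ Subgroup.mem_top _
  have hxy : Commute x y := (Subgroup.mem_centralizer_singleton_iff.1 hy).symm
  simpa using hxy.mul_right (l.central (y⁻¹ * g) (by simp [hyg]) x).symm

lemma eq_U_of_conj {x y : E} (hx : p x = u) (hy : p y = h) (hyx : y * x = x ^ 2 * y) : x = U := by
  obtain ⟨c, rfl⟩ : ∃ c, x = U * c := ⟨U⁻¹ * x, by simp⟩
  have hc : ∀ g, c * g = g * c := l.central c (by simpa [l.map_U] using hx)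
  have e₁ : H * (U * c) * H⁻¹ = (U * c) ^ 2 := by
    rw [conj_eq_of_map_eq l.central (l.map_H.trans hy.symm), hyx, mul_inv_cancel_right]
  have e₂ : H * (U * c) * H⁻¹ = U ^ 2 * c := by
    rw [← mul_assoc, l.H_U, mul_assoc _ H, ← hc H]; group
  rw [e₂, (show Commute U c from (hc U).symm).mul_pow, mul_right_inj, pow_two,
    left_eq_mul] at e₁
  rw [e₁, mul_one]

/-- An element lifting a central element is central. -/
lemma commute_of_map {k : E} (hu : Commute (p k) u) (hw : Commute (p k) w)
    (hh : Commute (p k) h) (g : E) : Commute k g := by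
  have hU : Commute k U := by
    rw [Commute, SemiconjBy, ← mul_inv_eq_iff_eq_mul]
    refine l.eq_U_of_conj (y := k * H * k⁻¹) ?_ ?_ ?_
    · simp [l.map_U, hu.eq]
    · simp [l.map_H, hh.eq]
    · rw [conj_pow, conj_mul, conj_mul, l.H_U]
  have hW : Commute k W := by
    have hV : Commute k (W * U * W⁻¹) := by
      have := conj_eq_of_map_eq l.central (x := k * W) (y := W * k) (by simp [l.map_W, hw.eq]) U
      rw [Commute, SemiconjBy, ← mul_inv_eq_iff_eq_mul]
      calc _ = (k * W) * U * (k * W)⁻¹ := by group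
        _ = W * (k * U) * (W * k)⁻¹ := by rw [this]; group
        _ = _ := by rw [hU.eq]; group
    rw [l.W_eq]
    exact (hU.mul_right hV).mul_right hU
  exact l.commute_of_commute hU hW g

lemma torusRelations : TorusRelations U (H * W * H⁻¹ * W⁻¹) W := by
  have hWW (g) : Commute (W * W) g := by
    apply l.commute_of_map <;> rw [map_mul, l.map_W, Commute, SemiconjBy] <;> decide +kernel
  have hH3 (g) : Commute (H ^ 3) g := by
    apply l.commute_of_map <;> rw [map_pow, l.map_H, Commute, SemiconjBy] <;> decide +kernel
  have U_pow : U ^ 7 = 1 := by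
    have h7 : p (U ^ 7) = 1 := by rw [map_pow, l.map_U]; decide +kernel
    have : SemiconjBy H U (U ^ 2) := l.H_U
    have h14 := (this.pow_right 7).eq
    rw [← l.central _ h7, mul_left_inj, ← pow_mul, mul_comm 2 7, pow_mul, pow_two,
      left_eq_mul] at h14
    exact h14
  obtain ⟨D, hD⟩ : ∃ D, D = H * W * H⁻¹ * W⁻¹ := ⟨_, rfl⟩
  rw [← hD]
  have pD : p D = h ^ 2 := by
    simp only [hD, map_mul, map_inv, l.map_H, l.map_W]
    decide +kernel
  have hDH (g) : D * g * D⁻¹ = H * (H * g * H⁻¹) * H⁻¹ := by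
    rw [conj_eq_of_map_eq l.central (x := D) (y := H * H) (by simp [pD, l.map_H, pow_two]) g]
    group
  have H_W : H * W * H⁻¹ = D * W := by rw [hD]; group
  have H_D : H * D * H⁻¹ = D := by
    have hDHH : D * H * D⁻¹ = H := by rw [hDH]; group
    nth_rw 1 [← hDHH]
    group
  have H2_W : H * (H * W * H⁻¹) * H⁻¹ = D ^ 2 * W := by
    rw [H_W, ← conj_mul, H_D, H_W, pow_two, mul_assoc]
  have H_U : H * U * H⁻¹ = U ^ 2 := by rw [l.H_U, mul_inv_cancel_right]
  set V := W * U * W⁻¹ with hV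
  have H_V' : H⁻¹ * V * H⁻¹⁻¹ = V ^ 2 := by
    rw [conj_eq_of_map_eq l.central (x := H⁻¹) (y := W * H * W⁻¹)]
    · calc _ = W * (H * U * H⁻¹) * W⁻¹ := by rw [hV]; group
        _ = _ := by rw [H_U, hV, conj_pow]
    · simp only [map_mul, map_inv, l.map_H, l.map_W]
      decide +kernel
  have H_V : H * V * H⁻¹ = V ^ 4 := by
    have V7 : V ^ 7 = 1 := by rw [hV, conj_pow, U_pow]; group
    have e : V = H * V ^ 2 * H⁻¹ := by rw [← H_V']; group
    calc _ = H * (V ^ 2) ^ 4 * H⁻¹ := by rw [← pow_mul, pow_succ V 7, V7, one_mul]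
      _ = V ^ 4 := by rw [← conj_pow, ← e]
  have W_U₄ : D * W = U ^ 2 * V ^ 4 * U ^ 2 := by
    rw [← H_W, ← H_V, ← H_U, conj_mul, conj_mul, ← l.W_eq]
  refine ⟨U_pow, ?_, ?_, ?_, (hWW U).eq, l.W_eq, W_U₄, ?_⟩
  · have : H ^ 3 * W * (H ^ 3)⁻¹ = D ^ 3 * W := by
      calc _ = H * (H * (H * W * H⁻¹) * H⁻¹) * H⁻¹ := by rw [pow_three]; group
        _ = _ := by rw [H2_W, ← conj_mul, ← conj_pow, H_D, H_W, pow_succ D 2, mul_assoc]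
    rwa [(hH3 W).eq, mul_inv_cancel_right, right_eq_mul] at this
  · rw [← mul_inv_eq_iff_eq_mul, hDH, H_U, ← conj_pow, H_U, ← pow_mul]
  · calc W * D = W * H * W * (H⁻¹ * (W * W)⁻¹) * W := by rw [hD]; group
      _ = W * H * W * ((W * W)⁻¹ * H⁻¹) * W := by rw [((hWW H).inv_inv).eq]
      _ = _ := by rw [hD]; group
  · have V7 : V ^ 7 = 1 := by rw [hV, conj_pow, U_pow]; group
    rw [← H2_W, H_W, W_U₄, ← conj_mul, ← conj_mul, ← conj_pow, ← conj_pow, H_U, H_V, ← pow_mul,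
      ← pow_mul, pow_eq_pow_mod (4 * 4) V7]

lemma eq_one_of_isBruhat {x : E} (hx : TorusRelations.IsBruhat U (H * W * H⁻¹ * W⁻¹) W x)
    (px : p x = 1) : x = 1 := by
  have r := l.torusRelations
  set D := H * W * H⁻¹ * W⁻¹ with hD
  have pD : p D = h ^ 2 := by
    simp only [hD, map_mul, map_inv, l.map_H, l.map_W]
    decide +kernel
  have WW : (W * W) ^ 2 = 1 := by rw [← pow_two, ← pow_mul, r.W_pow_four]
  have red (a i j : ℕ) : ∃ (a' : Fin 7) (i' : Fin 3) (j' : Fin 2),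
      U ^ a * D ^ i * (W * W) ^ j = U ^ a'.val * D ^ i'.val * (W * W) ^ j'.val :=
    ⟨⟨a % 7, Nat.mod_lt _ (by norm_num)⟩, ⟨i % 3, Nat.mod_lt _ (by norm_num)⟩,
      ⟨j % 2, Nat.mod_lt _ (by norm_num)⟩, by
        simp only [← pow_eq_pow_mod _ r.U_pow, ← pow_eq_pow_mod _ r.D_pow, ← pow_eq_pow_mod _ WW]⟩
  obtain ⟨a, i, j, rfl⟩ | ⟨_, b, ⟨a, i, j, rfl⟩, rfl⟩ := hx <;>
    obtain ⟨a, i, j, h⟩ := red a i j <;> rw [h] at px ⊢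
  · simp only [map_mul, map_pow, l.map_U, l.map_W, pD] at px
    obtain ⟨rfl, rfl, rfl⟩ := borel_eq_one a i j px
    simp
  · rw [r.U_pow_mod b] at px
    simp only [map_mul, map_pow, l.map_U, l.map_W, pD] at px
    exact absurd px (bruhat_ne_one a i j ⟨b % 7, Nat.mod_lt _ (by norm_num)⟩)

end IsLift

/-- Every central extension of `SL(2, 7)` splits. -/
theorem exists_section (central : ∀ k, p k = 1 → ∀ g, k * g = g * k)
    (hp : Function.Surjective p) :
    ∃ s : SpecialLinearGroup (Fin 2) (ZMod 7) →* E, ∀ g, p (s g) = g := by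
  obtain ⟨U, W, H, l⟩ := exists_isLift central hp
  set q := p.comp (Subgroup.closure {U, W}).subtype with hq
  have inj : Function.Injective q := by
    rw [injective_iff_map_eq_one]
    intro x hx
    exact Subtype.ext
      (l.eq_one_of_isBruhat (l.torusRelations.isBruhat_of_mem_closure x.2) hx)
  have surj : Function.Surjective q := by
    rw [← MonoidHom.range_eq_top, eq_top_iff, ← closure_u_w, Subgroup.closure_le]
    rintro _ (rfl | rfl)
    · exact ⟨⟨U, Subgroup.subset_closure (by simp)⟩, l.map_U⟩
    · exact ⟨⟨W, Subgroup.subset_closure (by simp)⟩, l.map_W⟩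
  let e := MulEquiv.ofBijective q ⟨inj, surj⟩
  exact ⟨(Subgroup.subtype _).comp e.symm.toMonoidHom, fun g => e.apply_symm_apply g⟩

end Extension

end SL2F7

section TwoCocycle

variable {G A : Type*} [Group G] [AddCommGroup A]

/-- The set underlying the central extension of `G` by `A` defined by a 2-cocycle `f`. -/
@[ext]
structure CocycleExtension_s10 (f : G × G → A) where
  fst : A
  snd : G

/-- The group law on the central extension defined by a 2-cocycle. -/
abbrev CocycleExtension_s10.group (f : G × G → A)
    (hf : ∀ g h j, f (g * h, j) + f (g, h) = f (h, j) + f (g, h * j)) :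
    Group (CocycleExtension_s10 f) :=
  have one_left (g : G) : f (1, g) = f (1, 1) := by
    have := hf 1 1 g
    rw [one_mul, one_mul, add_right_inj] at this
    exact this.symm
  { mul := fun x y => ⟨x.fst + y.fst + f (x.snd, y.snd), x.snd * y.snd⟩
    one := ⟨-f (1, 1), 1⟩
    inv := fun x => ⟨-f (1, 1) - x.fst - f (x.snd⁻¹, x.snd), x.snd⁻¹⟩
    mul_assoc := fun x y z => CocycleExtension_s10.ext
      (by
        change x.fst + y.fst + f (x.snd, y.snd) + z.fst + f (x.snd * y.snd, z.snd) =
          x.fst + (y.fst + z.fst + f (y.snd, z.snd)) + f (x.snd, y.snd * z.snd)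
        have := hf x.snd y.snd z.snd
        calc _ = x.fst + y.fst + z.fst + (f (x.snd * y.snd, z.snd) + f (x.snd, y.snd)) := by abel
          _ = _ := by rw [this]; abel)
      (mul_assoc _ _ _)
    one_mul := fun x => CocycleExtension_s10.ext
      (by change -f (1, 1) + x.fst + f (1, x.snd) = x.fst; rw [one_left x.snd]; abel) (one_mul _)
    mul_one := fun x => CocycleExtension_s10.ext
      (by
        change x.fst + -f (1, 1) + f (x.snd, 1) = x.fst
        have := hf x.snd 1 1
        rw [mul_one, mul_one, add_left_inj] at this
        rw [this]; abel) (mul_one _)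
    inv_mul_cancel := fun x => CocycleExtension_s10.ext
      (by
        change -f (1, 1) - x.fst - f (x.snd⁻¹, x.snd) + x.fst + f (x.snd⁻¹, x.snd) = -f (1, 1)
        abel) (inv_mul_cancel _) }

/-- If every central extension of `G` splits, then every 2-cocycle with trivial action is a
coboundary. -/
lemma exists_cochain_of_exists_section {G A : Type} [Group G] [AddCommGroup A]
    (hG : ∀ (E : Type) [Group E] (p : E →* G), (∀ k, p k = 1 → ∀ g, k * g = g * k) →
      Function.Surjective p → ∃ s : G →* E, ∀ g, p (s g) = g)
    (f : G × G → A) (hf : ∀ g h j, f (g * h, j) + f (g, h) = f (h, j) + f (g, h * j)) :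
    ∃ β : G → A, ∀ g h, f (g, h) = β h - β (g * h) + β g := by
  let := CocycleExtension_s10.group f hf
  let p : CocycleExtension_s10 f →* G :=
    { toFun := CocycleExtension_s10.snd, map_one' := rfl, map_mul' := fun _ _ => rfl }
  obtain ⟨s, hs⟩ := hG (CocycleExtension_s10 f) p
    (fun k hk g => CocycleExtension_s10.ext
      (by
        change k.snd = 1 at hk
        change k.fst + g.fst + f (k.snd, g.snd) = g.fst + k.fst + f (g.snd, k.snd)
        have h₁ := hf 1 1 g.snd
        have h₂ := hf g.snd 1 1
        rw [one_mul, one_mul, add_right_inj] at h₁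
        rw [mul_one, mul_one, add_left_inj] at h₂
        rw [hk, ← h₁, h₂, add_comm k.fst])
      (by
        change k.snd = 1 at hk
        change k.snd * g.snd = g.snd * k.snd
        rw [hk, one_mul, mul_one]))
    (fun g => ⟨⟨0, g⟩, rfl⟩)
  refine ⟨fun g => -(s g).fst, fun g h => ?_⟩
  have hs (g) : (s g).snd = g := hs g
  have : (s (g * h)).fst = (s g).fst + (s h).fst + f ((s g).snd, (s h).snd) :=
    congrArg CocycleExtension_s10.fst (map_mul s g h)
  rw [hs, hs] at this
  simp only [this]
  abel

end TwoCocycle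

lemma AddCircle.eq_zero_or_eq_half {φ : AddCircle (1 : ℚ)} (h : φ + φ = 0) :
    φ = 0 ∨ φ = ((1 / 2 : ℚ) : AddCircle (1 : ℚ)) := by
  induction φ using QuotientAddGroup.induction_on with
  | H q =>
  rw [← AddCircle.coe_add, AddCircle.coe_eq_zero_iff] at h
  obtain ⟨n, hn⟩ := h
  rw [zsmul_one] at hn
  obtain ⟨m, rfl | rfl⟩ := n.even_or_odd'
  · left
    rw [AddCircle.coe_eq_zero_iff]
    exact ⟨m, by rw [zsmul_one]; push_cast at hn; linarith⟩
  · right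
    rw [← sub_eq_zero, ← AddCircle.coe_sub, AddCircle.coe_eq_zero_iff]
    exact ⟨m, by rw [zsmul_one]; push_cast at hn; linarith⟩

lemma AddCircle.half_ne_zero : ((1 / 2 : ℚ) : AddCircle (1 : ℚ)) ≠ 0 := by
  rw [Ne, AddCircle.coe_eq_zero_iff]
  rintro ⟨n, hn⟩
  rw [zsmul_one] at hn
  have : (2 * n : ℤ) = 1 := by
    have : (2 * n : ℚ) = 1 := by rw [hn]; norm_num
    exact_mod_cast this
  omega

lemma AddCircle.half_add_half :
    ((1 / 2 : ℚ) : AddCircle (1 : ℚ)) + ((1 / 2 : ℚ) : AddCircle (1 : ℚ)) = 0 := by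
  rw [← AddCircle.coe_add, add_halves, AddCircle.coe_period]

namespace SL2F7

open Matrix

lemma w_mul_w_ne_one : w * w ≠ 1 := by decide +kernel

lemma w_mul_w_sq : w * w * (w * w) = 1 := by decide +kernel

lemma mem_center_iff_eq (k : SpecialLinearGroup (Fin 2) (ZMod 7)) :
    k ∈ Subgroup.center (SpecialLinearGroup (Fin 2) (ZMod 7)) ↔ k = 1 ∨ k = w * w := by
  rw [Matrix.SpecialLinearGroup.mem_center_iff]
  constructor
  · rintro ⟨r, hr, hk⟩
    have : ∀ r : ZMod 7, r ^ Fintype.card (Fin 2) = 1 → r = 1 ∨ r = -1 := by decide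
    obtain rfl | rfl := this r hr
    · exact .inl (Subtype.ext (hk.symm.trans (by decide +kernel)))
    · exact .inr (Subtype.ext (hk.symm.trans (by decide +kernel)))
  · rintro (rfl | rfl)
    · exact ⟨1, by decide +kernel, by decide +kernel⟩
    · exact ⟨-1, by decide +kernel, by decide +kernel⟩

local notation "S" => SpecialLinearGroup (Fin 2) (ZMod 7)
local notation "π" => QuotientGroup.mk' (Subgroup.center (SpecialLinearGroup (Fin 2) (ZMod 7)))

lemma mk_eq_mk_iff (g k : S) : π g = π k ↔ k = g ∨ k = g * (w * w) := by
  rw [QuotientGroup.mk'_apply, QuotientGroup.mk'_apply, QuotientGroup.eq, mem_center_iff_eq,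
    inv_mul_eq_one, inv_mul_eq_iff_eq_mul, @eq_comm _ g k]

lemma mk_mul_w_mul_w (g : S) : π (g * (w * w)) = π g :=
  ((mk_eq_mk_iff _ _).2 (.inr rfl)).symm

variable {A : Type} [AddCommGroup A]

lemma exists_cochain (f : S × S → A)
    (hf : ∀ g h j, f (g * h, j) + f (g, h) = f (h, j) + f (g, h * j)) :
    ∃ β : S → A, ∀ g h, f (g, h) = β h - β (g * h) + β g :=
  exists_cochain_of_exists_section (fun _ _ _ hc hp => exists_section hc hp) f hf

/-- The inflation of a cocycle on `PSL(2, 7)` is a coboundary; the translation behaviour of a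
trivializing cochain is given by an element of order at most two. -/
lemma exists_twisted_cochain (f : (S ⧸ Subgroup.center S) × (S ⧸ Subgroup.center S) → A)
    (hf : ∀ g h j, f (g * h, j) + f (g, h) = f (h, j) + f (g, h * j)) :
    ∃ (β : S → A) (φ : A), φ + φ = 0 ∧ (∀ g, β (g * (w * w)) = β g + φ) ∧
      ∀ g h, f (π g, π h) = β h - β (g * h) + β g := by
  obtain ⟨β, hβ⟩ := exists_cochain (fun x => f (π x.1, π x.2)) fun g h j => by
    simpa only [map_mul] using hf (π g) (π h) (π j)
  have key (g) : β (g * (w * w)) = β g + (β (w * w) - β 1) := by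
    have h₁ := hβ g (w * w)
    have h₂ := hβ g 1
    have h₃ : π (w * w) = π 1 := by rw [← mk_mul_w_mul_w 1, one_mul]
    simp only [h₃] at h₁
    rw [h₁, mul_one] at h₂
    rw [← sub_eq_zero] at h₂ ⊢
    rw [← neg_eq_zero, ← h₂]
    abel
  refine ⟨β, β (w * w) - β 1, ?_, key, hβ⟩
  have := key (w * w)
  rw [w_mul_w_sq, ← sub_eq_zero] at this
  rw [← neg_eq_zero, ← this]
  abel

lemma exists_cochain_of_invariant (f : (S ⧸ Subgroup.center S) × (S ⧸ Subgroup.center S) → A)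
    (β : S → A) (hβ : ∀ g, β (g * (w * w)) = β g)
    (hf : ∀ g h, f (π g, π h) = β h - β (g * h) + β g) :
    ∃ γ : S ⧸ Subgroup.center S → A, ∀ x y, f (x, y) = γ y - γ (x * y) + γ x := by
  have hγ (g) : β (Quotient.out (π g)) = β g := by
    obtain h | h := (mk_eq_mk_iff g (Quotient.out (π g))).1 (QuotientGroup.out_eq' _).symm <;>
      rw [h]
    exact hβ g
  refine ⟨fun x => β (Quotient.out x), fun x y => ?_⟩
  obtain ⟨g, rfl⟩ := QuotientGroup.mk'_surjective _ x
  obtain ⟨h, rfl⟩ := QuotientGroup.mk'_surjective _ y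
  simp only [hf, ← map_mul, hγ]

lemma exists_cocycle {ε : A} (hε : ε + ε = 0) :
    ∃ (f : (S ⧸ Subgroup.center S) × (S ⧸ Subgroup.center S) → A) (β : S → A),
      (∀ g, β (g * (w * w)) = β g + ε) ∧ (∀ g h, f (π g, π h) = β h - β (g * h) + β g) ∧
      ∀ g h j, f (g * h, j) + f (g, h) = f (h, j) + f (g, h * j) := by
  classical
  let β : S → A := fun g => if g = Quotient.out (π g) then 0 else ε
  have hβ (g) : β (g * (w * w)) = β g + ε := by
    simp only [β, mk_mul_w_mul_w]
    have := (mk_eq_mk_iff g (Quotient.out (π g))).1 (QuotientGroup.out_eq' _).symm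
    by_cases h : g = Quotient.out (π g)
    · rw [if_pos h, ← h, if_neg (by rw [mul_eq_left]; exact w_mul_w_ne_one), zero_add]
    · rw [if_neg h, if_pos (this.resolve_left (Ne.symm h)).symm, hε]
  have hβ' (g) : Quotient.out (π g) = g ∨ Quotient.out (π g) = g * (w * w) :=
    (mk_eq_mk_iff _ _).1 (QuotientGroup.out_eq' _).symm
  have hc (g : S) : g * (w * w) = w * w * g :=
    Subgroup.mem_center_iff.1 ((mem_center_iff_eq _).2 (.inr rfl)) g
  have hf (g h : S) : β (Quotient.out (π h)) - β (Quotient.out (π g) * Quotient.out (π h)) +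
      β (Quotient.out (π g)) = β h - β (g * h) + β g := by
    obtain hg | hg := hβ' g <;> obtain hh | hh := hβ' h <;> rw [hg, hh]
    · rw [← mul_assoc g, hβ, hβ]; abel
    · rw [mul_assoc, ← hc, ← mul_assoc, hβ, hβ]; abel
    · rw [mul_assoc, ← mul_assoc (w * w), ← hc h, mul_assoc h, w_mul_w_sq, mul_one, hβ, hβ]
      calc _ = β h - β (g * h) + β g + (ε + ε) := by abel
        _ = _ := by rw [hε, add_zero]
  refine ⟨fun x => β (Quotient.out x.2) - β (Quotient.out x.1 * Quotient.out x.2) +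
    β (Quotient.out x.1), β, hβ, hf, fun x y z => ?_⟩
  obtain ⟨g, rfl⟩ := QuotientGroup.mk'_surjective _ x
  obtain ⟨h, rfl⟩ := QuotientGroup.mk'_surjective _ y
  obtain ⟨j, rfl⟩ := QuotientGroup.mk'_surjective _ z
  simp only [← map_mul, hf, mul_assoc]
  abel

lemma not_exists_cochain (f : (S ⧸ Subgroup.center S) × (S ⧸ Subgroup.center S) → A)
    (β : S → A) {ε : A} (hε : ε ≠ 0) (hβ : ∀ g, β (g * (w * w)) = β g + ε)
    (hf : ∀ g h, f (π g, π h) = β h - β (g * h) + β g) :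
    ¬ ∃ γ : S ⧸ Subgroup.center S → A, ∀ x y, f (x, y) = γ y - γ (x * y) + γ x := by
  rintro ⟨γ, hγ⟩
  have hmul (g h : S) : β (g * h) - γ (π (g * h)) = β g - γ (π g) + (β h - γ (π h)) := by
    have := hf g h
    rw [hγ, ← map_mul, ← sub_eq_zero] at this
    rw [← sub_eq_zero, ← this]
    abel
  let χ : S →* Multiplicative A :=
    MonoidHom.mk' (fun g => .ofAdd (β g - γ (π g))) fun g h => congrArg _ (hmul g h)
  have hχ (g) : β g = γ (π g) := sub_eq_zero.1 (monoidHom_apply_eq_one χ g)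
  have := hβ 1
  rw [hχ, hχ, mk_mul_w_mul_w, left_eq_add] at this
  exact hε this

lemma mem_coboundaries₂_iff {G : Type} [Group G] (f : G × G → A) :
    f ∈ groupCohomology.coboundaries₂ (Rep.trivial ℤ G A) ↔
      ∃ γ : G → A, ∀ x y, f (x, y) = γ y - γ (x * y) + γ x :=
  ⟨fun ⟨γ, hγ⟩ => ⟨γ, fun x y => (congrFun hγ (x, y)).symm⟩,
    fun ⟨γ, hγ⟩ => ⟨γ, funext fun x => (hγ x.1 x.2).symm⟩⟩

theorem nonempty_H2_addEquiv :
    Nonempty (groupCohomology (Rep.trivial ℤ (S ⧸ Subgroup.center S) (AddCircle (1 : ℚ))) 2 ≃+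
      ZMod 2) := by
  obtain ⟨f₀, β₀, hβ₀, hf₀, hcocycle⟩ := exists_cocycle AddCircle.half_add_half
  let c : groupCohomology.cocycles₂ (Rep.trivial ℤ (S ⧸ Subgroup.center S) (AddCircle (1 : ℚ))) :=
    ⟨f₀, (groupCohomology.mem_cocycles₂_iff _).2 hcocycle⟩
  have hcard : Nat.card (groupCohomology
      (Rep.trivial ℤ (S ⧸ Subgroup.center S) (AddCircle (1 : ℚ))) 2) = 2 := by
    rw [Nat.card_eq_two_iff]
    refine ⟨0, groupCohomology.H2π _ c, ?_, Set.eq_univ_of_forall fun x => ?_⟩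
    · intro h
      exact not_exists_cochain f₀ β₀ AddCircle.half_ne_zero hβ₀ hf₀
        ((mem_coboundaries₂_iff f₀).1 ((groupCohomology.H2π_eq_zero_iff c).1 h.symm))
    · induction x using groupCohomology.H2_induction_on with
      | h f =>
      obtain ⟨β, φ, hφ, hβ, hf⟩ := exists_twisted_cochain f.1
        ((groupCohomology.mem_cocycles₂_iff _).1 f.2)
      obtain rfl | rfl := AddCircle.eq_zero_or_eq_half hφ
      · left
        exact (groupCohomology.H2π_eq_zero_iff f).2 ((mem_coboundaries₂_iff f.1).2
          (exists_cochain_of_invariant f.1 β (fun g => (hβ g).trans (add_zero _)) hf))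
      · right
        refine (groupCohomology.H2π_eq_iff f c).2 ((mem_coboundaries₂_iff (f.1 - f₀)).2
          (exists_cochain_of_invariant (f.1 - f₀) (β - β₀) (fun g => ?_) fun g h => ?_))
        · rw [Pi.sub_apply, Pi.sub_apply, hβ, hβ₀, add_sub_add_right_eq_sub]
        · rw [Pi.sub_apply, hf, hf₀]
          simp only [Pi.sub_apply]
          abel
  have := isAddCyclic_of_prime_card (p := 2) hcard
  exact ⟨((zmodAddCyclicAddEquiv this).symm.trans (ZMod.ringEquivCongr hcard).toAddEquiv)⟩

end SL2F7

section DimensionShift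

open CategoryTheory Limits

variable {G : Type} [Group G]

/-- The inclusion of constant functions into the coinduced representation. -/
noncomputable def Rep.trivialToCoind (V : Type) [AddCommGroup V] :
    Rep.trivial ℤ G V ⟶
      Rep.coind (⊥ : Subgroup G).subtype (Rep.trivial ℤ (⊥ : Subgroup G) V) :=
  Rep.ofHom
    { toFun := fun v => ⟨fun _ => v, fun _ _ => rfl⟩
      map_add' := fun _ _ => rfl
      map_smul' := fun _ _ => rfl
      isIntertwining' := fun _ => rfl }

/-- The averaging map from the coinduced representation. -/
noncomputable def Rep.coindToTrivial (V : Type) [AddCommGroup V] [Module ℚ V] [Fintype G] :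
    Rep.coind (⊥ : Subgroup G).subtype (Rep.trivial ℤ (⊥ : Subgroup G) V) ⟶
      Rep.trivial ℤ G V :=
  Rep.ofHom
    { toFun := fun f => (Fintype.card G : ℚ)⁻¹ • ∑ g, f.1 g
      map_add' := fun f f' => by
        rw [← smul_add, ← Finset.sum_add_distrib]; rfl
      map_smul' := fun n f => by
        change (Fintype.card G : ℚ)⁻¹ • ∑ g, n • f.1 g = _
        rw [← Finset.smul_sum, smul_comm]; rfl
      isIntertwining' := fun g => by
        ext f
        exact congrArg ((Fintype.card G : ℚ)⁻¹ • ·)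
          (Fintype.sum_equiv (Equiv.mulRight g) (fun x => f.1 (x * g)) f.1 fun _ => rfl) }

lemma isZero_groupCohomology_trivial_of_finite [Finite G] (V : Type) [AddCommGroup V]
    [Module ℚ V] (n : ℕ) : IsZero (groupCohomology (Rep.trivial ℤ G V) (n + 1)) := by
  have := Fintype.ofFinite G
  have h : IsZero (groupCohomology
      (Rep.coind (⊥ : Subgroup G).subtype (Rep.trivial ℤ (⊥ : Subgroup G) V)) (n + 1)) :=
    (isZero_groupCohomology_succ_of_subsingleton _ n).of_iso (groupCohomology.coindIso _ _)
  have e : Rep.trivialToCoind V ≫ Rep.coindToTrivial V = 𝟙 (Rep.trivial ℤ G V) := by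
    ext v
    change (Fintype.card G : ℚ)⁻¹ • ∑ _ : G, v = v
    rw [Finset.sum_const, Finset.card_univ, ← Nat.cast_smul_eq_nsmul ℚ, inv_smul_smul₀]
    exact_mod_cast Fintype.card_ne_zero
  rw [IsZero.iff_id_eq_zero]
  have e' := congrArg (groupCohomology.functor ℤ G (n + 1)).map e
  rw [CategoryTheory.Functor.map_comp, CategoryTheory.Functor.map_id] at e'
  exact e'.symm.trans (by
    rw [h.eq_zero_of_tgt ((groupCohomology.functor ℤ G (n + 1)).map (Rep.trivialToCoind V))]
    exact zero_comp)

/-- The exact sequence `0 → ℤ → ℚ → ℚ/ℤ → 0` of trivial representations. -/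
noncomputable def intRatSequence (G : Type) [Group G] : ShortComplex (Rep ℤ G) :=
  .mk (X₁ := Rep.trivial ℤ G ℤ) (X₂ := Rep.trivial ℤ G ℚ)
    (X₃ := Rep.trivial ℤ G (AddCircle (1 : ℚ)))
    (Rep.ofHom ⟨(Int.castAddHom ℚ).toIntLinearMap, fun _ => rfl⟩)
    (Rep.ofHom ⟨QuotientAddGroup.mk' (AddSubgroup.zmultiples (1 : ℚ)) |>.toIntLinearMap,
      fun _ => rfl⟩)
    (by
      ext
      exact (QuotientAddGroup.eq_zero_iff _).2 ⟨1, (one_zsmul (1 : ℚ)).trans Int.cast_one.symm⟩)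

lemma Rep.shortExact_of_injective_of_surjective {k G : Type} [CommRing k] [Group G]
    (X : ShortComplex (Rep k G)) (hf : Function.Injective X.f.hom)
    (hfg : ∀ x, X.g.hom x = 0 → ∃ y, X.f.hom y = x) (hg : Function.Surjective X.g.hom) :
    X.ShortExact where
  exact := by
    rw [← ShortComplex.exact_map_iff_of_faithful _ (forget₂ (Rep k G) (ModuleCat k)),
      ShortComplex.moduleCat_exact_iff]
    exact hfg
  mono_f := (Rep.mono_iff_injective _).2 hf
  epi_g := (Rep.epi_iff_surjective _).2 hg

lemma intRatSequence_shortExact (G : Type) [Group G] : (intRatSequence G).ShortExact :=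
  Rep.shortExact_of_injective_of_surjective _ (fun _ _ h => Int.cast_injective (α := ℚ) h)
    (fun x hx => by
      obtain ⟨n, hn⟩ := (QuotientAddGroup.eq_zero_iff (N := AddSubgroup.zmultiples (1 : ℚ)) x).1 hx
      exact ⟨n, (zsmul_one n).symm.trans hn⟩)
    (QuotientAddGroup.mk'_surjective (AddSubgroup.zmultiples (1 : ℚ)))

theorem nonempty_groupCohomology_int_addEquiv [Finite G] (n : ℕ) :
    Nonempty (groupCohomology (Rep.trivial ℤ G (AddCircle (1 : ℚ))) (n + 1) ≃+
      groupCohomology (Rep.trivial ℤ G ℤ) (n + 2)) := by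
  have := groupCohomology.isIso_δ_of_isZero (intRatSequence_shortExact G) (n + 1)
    (isZero_groupCohomology_trivial_of_finite ℚ n)
    (isZero_groupCohomology_trivial_of_finite ℚ (n + 1))
  exact ⟨(asIso (groupCohomology.δ (intRatSequence_shortExact G) (n + 1) (n + 2)
    rfl)).toLinearEquiv.toAddEquiv⟩

end DimensionShift

/-- `H³(L₂(7), ℤ) ≅ ℤ/2ℤ`, where `L₂(7) = PSL(2, 𝔽₇)` is the quotient of `SL(2, ℤ/7ℤ)`
by its center. -/
theorem groupCohomology_three_PSL2_F7 :
    Nonempty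
      ((groupCohomology
          (Rep.trivial ℤ
            (Matrix.SpecialLinearGroup (Fin 2) (ZMod 7) ⧸
              Subgroup.center (Matrix.SpecialLinearGroup (Fin 2) (ZMod 7))) ℤ) 3)
        ≃+ ZMod 2) := by
  obtain ⟨e⟩ := nonempty_groupCohomology_int_addEquiv (G :=
    Matrix.SpecialLinearGroup (Fin 2) (ZMod 7) ⧸
      Subgroup.center (Matrix.SpecialLinearGroup (Fin 2) (ZMod 7))) 1
  obtain ⟨e'⟩ := SL2F7.nonempty_H2_addEquiv
  exact ⟨e.symm.trans e'⟩
end
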